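/- Let p be a regular prime (p odd and p does not divide the class number of Q(ζ_p)) and N a prime with N ≡ 1 (mod p). Then rk_p(Cl(L)) ≤ (p-1)(p-2), where L = Q(ζ_p, N^{1/p}). -/

import Mathlib

open NumberField Polynomial

/-- The `p`-rank of a finite abelian group `G`: the `𝔽_p`-dimension of `G ⊗ 𝔽_p`,
equivalently of `G[p]`. -/
noncomputable def pRank (p : ℕ) (G : Type*) [Group G] : ℕ :=
  (Nat.card {g : G // g ^ p = 1}).factorization p

section BlockA

open Polynomial

/-- geometric sum mod p -/
lemma geom_mod_p (p : ℕ) (hp : p.Prime) :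
    ∃ g : ℤ[X], (X - 1 : ℤ[X]) ^ (p - 1) = ∑ i ∈ Finset.range p, X ^ i + C (p : ℤ) * g := by
  have := Fact.mk hp
  have h : C (p : ℤ) ∣ ((X - 1 : ℤ[X]) ^ (p - 1) - ∑ i ∈ Finset.range p, X ^ i) := by
    rw [← Ideal.mem_span_singleton, ← Set.image_singleton, ← Ideal.map_span,
      Ideal.mem_map_C_iff]
    intro n
    rw [Ideal.mem_span_singleton, ← ZMod.intCast_zmod_eq_zero_iff_dvd, ← eq_intCast (Int.castRingHom (ZMod p)),
      ← coeff_map]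
    have : ((X - 1 : ℤ[X]) ^ (p - 1) - ∑ i ∈ Finset.range p, X ^ i).map (Int.castRingHom (ZMod p)) = 0 := by
      simp only [Polynomial.map_sub, Polynomial.map_pow, Polynomial.map_sum, map_X, Polynomial.map_one]
      rw [sub_eq_zero]
      have hne : (X - 1 : (ZMod p)[X]) ≠ 0 := X_sub_C_ne_zero 1
      apply mul_right_cancel₀ hne
      rw [geom_sum_mul, ← pow_succ, Nat.sub_add_cancel hp.one_le, sub_pow_char, one_pow]
    rw [this, coeff_zero]
  obtain ⟨g, hg⟩ := h
  exact ⟨g, by rw [← hg]; ring⟩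

lemma card_ker_comp {W : Type*} [AddCommGroup W] [Finite W] (f g : AddMonoid.End W) :
    Nat.card (f * g).ker ≤ Nat.card f.ker * Nat.card g.ker := by
  let φ : (f * g).ker →+ f.ker :=
    { toFun := fun x => ⟨g x, x.2⟩
      map_zero' := by ext; simp
      map_add' := by intro x y; ext; simp }
  have h1 := AddSubgroup.card_mul_index φ.ker
  rw [AddSubgroup.index_ker] at h1
  rw [← h1, mul_comm]
  apply Nat.mul_le_mul
  · exact AddSubgroup.card_le_card_addGroup _
  · refine Nat.card_le_card_of_injective (fun x : φ.ker => (⟨x.1.1, ?_⟩ : g.ker)) ?_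
    · have := x.2
      exact congrArg Subtype.val this
    · intro x y h
      exact Subtype.ext (Subtype.ext (congrArg (fun z : g.ker => z.1) h))

lemma card_ker_pow {W : Type*} [AddCommGroup W] [Finite W] (f : AddMonoid.End W) (n : ℕ) :
    Nat.card (f ^ n).ker ≤ Nat.card f.ker ^ n := by
  induction n with
  | zero =>
    have : (f ^ 0).ker = ⊥ := by
      ext x; exact Iff.rfl
    rw [this]; simp
  | succ n ih =>
    rw [pow_succ, pow_succ]
    exact (card_ker_comp _ _).trans (Nat.mul_le_mul_right _ ih)

lemma card_le_fixed_pow (p : ℕ) (hp : p.Prime) {W : Type*} [AddCommGroup W] [Finite W]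
    (s : AddMonoid.End W) (hpW : ∀ w : W, p • w = 0)
    (hN : ∀ w : W, ∑ i ∈ Finset.range p, (s ^ i) w = 0) :
    Nat.card W ≤ Nat.card (s - 1).ker ^ (p - 1) := by
  obtain ⟨g, hg⟩ := geom_mod_p p hp
  have h := congrArg (aeval s) hg
  simp only [map_pow, map_sub, map_add, map_sum, map_mul, aeval_X, aeval_C, map_one] at h
  have h2 : (s - 1) ^ (p - 1) = 0 := by
    rw [h]
    ext w
    have : (∑ i ∈ Finset.range p, s ^ i) w = 0 := by
      rw [← hN w]; exact AddMonoidHom.finsetSum_apply _ _ _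
    have e : (∑ i ∈ Finset.range p, s ^ i + algebraMap ℤ (AddMonoid.End W) (p : ℤ) * aeval s g) w =
      (∑ i ∈ Finset.range p, s ^ i) w + (p : AddMonoid.End W) (aeval s g w) := by
      simp only [eq_intCast, Int.cast_natCast]; rfl
    rw [e, this, AddMonoid.End.natCast_apply, hpW, add_zero]
    rfl
  have := card_ker_pow (s - 1) (p - 1)
  rw [h2] at this
  have h3 : (0 : AddMonoid.End W).ker = ⊤ := by ext; exact iff_of_true rfl trivial
  rw [h3] at this
  simpa using this

lemma finrank_range_add_ker_int {A T : Type*} [AddCommGroup A] [AddCommGroup T] [Module.Finite ℤ A]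
    (f : A →ₗ[ℤ] T) :
    Module.finrank ℤ (LinearMap.range f) + Module.finrank ℤ (LinearMap.ker f) = Module.finrank ℤ A := by
  rw [← f.quotKerEquivRange.finrank_eq, Submodule.finrank_quotient_add_finrank]

lemma index_nsmul_range_prod (p : ℕ) (A T : Type*) [AddCommGroup A] [AddCommGroup T] :
    (nsmulAddMonoidHom p : A × T →+ A × T).range.index =
      (nsmulAddMonoidHom p : A →+ A).range.index * (nsmulAddMonoidHom p : T →+ T).range.index := by
  rw [← AddSubgroup.index_prod]
  congr 1
  ext ⟨x, y⟩
  simp only [AddMonoidHom.mem_range, AddSubgroup.mem_prod, nsmulAddMonoidHom_apply]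
  constructor
  · rintro ⟨⟨a, b⟩, h⟩
    simp only [Prod.smul_mk, Prod.mk.injEq] at h
    exact ⟨⟨a, h.1⟩, ⟨b, h.2⟩⟩
  · rintro ⟨⟨a, ha⟩, ⟨b, hb⟩⟩
    exact ⟨(a, b), by simp only [Prod.smul_mk]; exact Prod.ext ha hb⟩

lemma index_nsmul_range_congr (p : ℕ) {A T : Type*} [AddCommGroup A] [AddCommGroup T] (e : A ≃+ T) :
    (nsmulAddMonoidHom p : A →+ A).range.index = (nsmulAddMonoidHom p : T →+ T).range.index := by
  rw [← AddSubgroup.index_map_of_bijective (f := e.toAddMonoidHom) e.bijective]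
  congr 1
  ext x
  simp only [AddSubgroup.mem_map, AddMonoidHom.mem_range, nsmulAddMonoidHom_apply]
  constructor
  · rintro ⟨_, ⟨a, rfl⟩, rfl⟩
    exact ⟨e a, by simp⟩
  · rintro ⟨a, rfl⟩
    exact ⟨_, ⟨e.symm a, rfl⟩, by simp⟩

lemma index_nsmul_range (p : ℕ) (hp : p ≠ 0) (Y : Type*) [AddCommGroup Y] [Module.Finite ℤ Y] :
    (nsmulAddMonoidHom p : Y →+ Y).range.index =
      p ^ Module.finrank ℤ Y * Nat.card (nsmulAddMonoidHom p : Y →+ Y).ker := by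
  have : AddGroup.FG Y := Module.Finite.iff_addGroup_fg.mp inferInstance
  obtain ⟨n, ι, _, q, hq, e, ⟨f⟩⟩ := AddCommGroup.equiv_free_prod_directSum_zmod Y
  have hne : ∀ i, NeZero (q i ^ e i) := fun i => ⟨pow_ne_zero _ (hq i).ne_zero⟩
  classical
  let T := DirectSum ι fun i => ZMod (q i ^ e i)
  have hfin : Finite T :=
    Finite.of_equiv _ (DirectSum.addEquivProd (fun i => ZMod (q i ^ e i))).symm.toEquiv
  have hr : Module.finrank ℤ Y = n := by
    rw [f.toIntLinearEquiv.finrank_eq]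
    have hT : Module.finrank ℤ T = 0 := by
      rw [Module.finrank_eq_zero_iff]
      intro x
      refine ⟨Nat.card T, by exact_mod_cast Nat.card_pos.ne', ?_⟩
      rw [natCast_zsmul]; exact card_nsmul_eq_zero'
    have h := finrank_range_add_ker_int (LinearMap.fst ℤ (Fin n →₀ ℤ) T)
    have h2 : Module.finrank ℤ (LinearMap.ker (LinearMap.fst ℤ (Fin n →₀ ℤ) T)) = 0 := by
      rw [LinearMap.ker_fst, LinearMap.finrank_range_of_inj LinearMap.inr_injective, hT]
    rw [h2, LinearMap.range_eq_top.mpr LinearMap.fst_surjective, finrank_top] at h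
    rw [← h]
    simp
  rw [index_nsmul_range_congr p f, index_nsmul_range_prod, hr]
  congr 1
  · have := AddSubgroup.index_range_nsmul (Fin n →₀ ℤ) p
    rw [this]; simp
  · rw [AddSubgroup.index_range]
    refine Nat.card_congr ⟨fun t => ⟨f.symm (0, t.1), ?_⟩, fun y => ⟨(f y.1).2, ?_⟩, ?_, ?_⟩
    · have ht : p • t.1 = 0 := t.2
      change p • f.symm _ = 0
      rw [← map_nsmul]
      simp [ht]
    · have hy : p • y.1 = 0 := y.2
      change p • (f y.1).2 = 0
      rw [← Prod.smul_snd, ← map_nsmul, hy]; simp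
    · intro t; simp
    · intro y
      have hy : p • y.1 = 0 := y.2
      have h1 : (f y.1).1 = 0 := by
        have : p • (f y.1).1 = 0 := by rw [← Prod.smul_fst, ← map_nsmul, hy]; simp
        exact (smul_eq_zero.mp this).resolve_left hp
      ext
      simp only
      rw [AddEquiv.symm_apply_eq]
      exact Prod.ext h1.symm rfl

/-- range of an additive endomorphism -/
def rg {Y : Type*} [AddCommGroup Y] (f : AddMonoid.End Y) : AddSubgroup Y :=
  AddMonoidHom.range (show Y →+ Y from f)

lemma mem_rg {Y : Type*} [AddCommGroup Y] (f : AddMonoid.End Y) (y : Y) : y ∈ rg f ↔ ∃ x, f x = y :=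
  Iff.rfl

lemma index_range_mul_dvd {Y : Type*} [AddCommGroup Y] (f g : AddMonoid.End Y) :
    (rg (f * g)).index ∣ (rg f).index * (rg g).index := by
  have h1 : rg (f * g) = (rg g).map (show Y →+ Y from f) := by
    ext x
    rw [mem_rg, AddSubgroup.mem_map]
    constructor
    · rintro ⟨y, rfl⟩; exact ⟨g y, ⟨y, rfl⟩, rfl⟩
    · rintro ⟨_, ⟨y, rfl⟩, rfl⟩; exact ⟨y, rfl⟩
  rw [h1, AddSubgroup.index_map, mul_comm]
  exact mul_dvd_mul_left _ (AddSubgroup.index_dvd_of_le le_sup_left)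

lemma index_range_pow_dvd {Y : Type*} [AddCommGroup Y] (f : AddMonoid.End Y) (n : ℕ) :
    (rg (f ^ n)).index ∣ (rg f).index ^ n := by
  induction n with
  | zero =>
    have : rg (f ^ 0) = ⊤ := by
      ext x; exact iff_of_true ⟨x, rfl⟩ trivial
    rw [this]; simp
  | succ n ih =>
    rw [pow_succ, pow_succ]
    exact (index_range_mul_dvd _ _).trans (mul_dvd_mul_right ih _)

lemma index_norm_zero (p : ℕ) (hp : p.Prime) {Y : Type*} [AddCommGroup Y]
    (s : AddMonoid.End Y) (hN : ∑ i ∈ Finset.range p, s ^ i = 0) :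
    (nsmulAddMonoidHom p : Y →+ Y).range.index ∣ (rg (s - 1)).index ^ (p - 1) ∧
    (rg (s - 1)).index ∣ (nsmulAddMonoidHom p : Y →+ Y).range.index := by
  constructor
  · refine dvd_trans ?_ (index_range_pow_dvd _ _)
    apply AddSubgroup.index_dvd_of_le
    obtain ⟨g, hg⟩ := geom_mod_p p hp
    have h := congrArg (aeval s) hg
    simp only [map_pow, map_sub, map_add, map_sum, map_mul, aeval_X, aeval_C, map_one] at h
    rw [h, hN, zero_add]
    rintro _ ⟨y, rfl⟩
    refine ⟨aeval s g y, ?_⟩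
    simp only [eq_intCast, Int.cast_natCast]
    rfl
  · apply AddSubgroup.index_dvd_of_le
    rintro _ ⟨y, rfl⟩
    have hd : (X - C 1 : ℤ[X]) ∣ ∑ i ∈ Finset.range p, X ^ i - C (p : ℤ) := by
      rw [dvd_iff_isRoot]; simp [eval_finsetSum]
    obtain ⟨g, hg⟩ := hd
    have h := congrArg (aeval s) hg
    simp only [map_pow, map_sub, map_sum, map_mul, aeval_X, aeval_C, map_one] at h
    rw [hN] at h
    refine ⟨aeval s (-g) y, ?_⟩
    have h2 : (s - 1) * aeval s (-g) = (p : AddMonoid.End Y) := by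
      rw [map_neg, mul_neg, ← h]; simp
    have := congrArg (fun z : AddMonoid.End Y => z y) h2
    simp only [AddMonoid.End.natCast_apply] at this
    exact this

/-- Herbrand quotient bookkeeping. -/
lemma herbrand_index {M : Type*} [AddCommGroup M] (d n : M →+ M)
    (hdn : ∀ x, d (n x) = 0) (hnd : ∀ x, n (d x) = 0) :
    (d.ker ⊔ n.ker).index * n.range.relIndex d.ker = (d.ker.map n).relIndex d.ker ∧
    (d.ker ⊔ n.ker).index * d.range.relIndex n.ker = (n.ker.map d).relIndex n.ker := by
  have key : ∀ (d n : M →+ M), (∀ x, d (n x) = 0) →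
      (d.ker ⊔ n.ker).index * n.range.relIndex d.ker = (d.ker.map n).relIndex d.ker := by
    intro d n h
    rw [← AddSubgroup.relIndex_mul_relIndex (d.ker.map n) n.range d.ker]
    · congr 1
      rw [AddMonoidHom.range_eq_map, AddSubgroup.relIndex_map_map]
      simp
    · rintro _ ⟨x, _, rfl⟩; exact ⟨x, rfl⟩
    · rintro _ ⟨x, rfl⟩; exact h x
  refine ⟨key d n hdn, ?_⟩
  rw [sup_comm]; exact key n d hnd

lemma finrank_addSubgroup_range_ker {M : Type*} [AddCommGroup M] [Module.Finite ℤ M] (n : M →+ M) :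
    Module.finrank ℤ n.range + Module.finrank ℤ n.ker = Module.finrank ℤ M :=
  finrank_range_add_ker_int n.toIntLinearMap

lemma finrank_addSubgroup_mono {M : Type*} [AddCommGroup M] [Module.Finite ℤ M] {A B : AddSubgroup M}
    (h : A ≤ B) : Module.finrank ℤ A ≤ Module.finrank ℤ B := 
  Submodule.finrank_mono (R := ℤ) (s := A.toIntSubmodule) (t := B.toIntSubmodule) h

instance finite_addSubgroup {M : Type*} [AddCommGroup M] [Module.Finite ℤ M] (A : AddSubgroup M) :
    Module.Finite ℤ A :=
  inferInstanceAs (Module.Finite ℤ A.toIntSubmodule)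

lemma finrank_p_arith (p r rd rn k : ℕ) (hodd : Odd p) (hr : 2 * r + 2 = p * (p - 1))
    (hd : 2 * rd + 3 ≤ p) (hn : r ≤ rd + rn) (hk : rn + 1 ≤ k * (p - 1)) : rd + 2 ≤ k := by
  obtain ⟨m, rfl⟩ := hodd
  simp only [Nat.add_sub_cancel] at *
  have h1 : rd + 1 ≤ m := by omega
  by_contra hlt
  have hkm : k ≤ m := by
    by_contra h
    omega
  nlinarith

lemma herbrand_units (p : ℕ) (hp : p.Prime) (hodd : Odd p) {M : Type*} [AddCommGroup M]
    [Module.Finite ℤ M] (s : AddMonoid.End M) (hs : s ^ p = 1) (d n : M →+ M)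
    (hd : ∀ x, d x = s x - x) (hn : ∀ x, n x = ∑ i ∈ Finset.range p, (s ^ i) x)
    (hr : 2 * Module.finrank ℤ M + 2 = p * (p - 1))
    (hk : 2 * Module.finrank ℤ d.ker + 3 = p)
    (ht : Nat.card (nsmulAddMonoidHom p : M →+ M).ker ≤ p)
    (htf : Finite (nsmulAddMonoidHom p : M →+ M).ker)
    (z : M) (hz0 : z ≠ 0) (hpz : p • z = 0) (hsz : s z = z) :
    p * n.range.relIndex d.ker ≤ d.range.relIndex n.ker ∧ n.range.relIndex d.ker ≠ 0 := by
  have hds : ∀ x, d (s x) = s (d x) := by intro x; rw [hd, hd, map_sub]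
  have hsn : ∀ x, s (n x) = n x := by
    intro x
    have e1 : s (n x) = ∑ i ∈ Finset.range p, (s ^ (i + 1)) x := by
      rw [hn, map_sum]
      refine Finset.sum_congr rfl fun i _ => ?_
      rw [pow_succ']; rfl
    have h2 := Finset.sum_range_succ' (fun i => (s ^ i) x) p
    rw [Finset.sum_range_succ] at h2
    rw [e1, hn]
    have h3 : (s ^ p) x = (s ^ 0) x := by rw [hs, pow_zero]
    rw [h3] at h2
    exact (add_right_cancel h2).symm
  have hns : ∀ x, n (s x) = n x := by
    intro x
    rw [← hsn x, hn, hn, map_sum]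
    refine Finset.sum_congr rfl fun i _ => ?_
    change (s ^ i * s) x = (s * s ^ i) x
    rw [← pow_succ, ← pow_succ']
  have hdn : ∀ x, d (n x) = 0 := by intro x; rw [hd, hsn, sub_self]
  have hnd : ∀ x, n (d x) = 0 := by intro x; rw [hd, map_sub, hns, sub_self]
  have hfix : ∀ x, s x = x → n x = p • x := by
    intro x hx
    have : ∀ i, (s ^ i) x = x := by
      intro i
      induction i with
      | zero => rfl
      | succ i ih => rw [pow_succ]; change (s ^ i) (s x) = x; rw [hx, ih]
    rw [hn]; simp [this]
  have hker : ∀ x, x ∈ d.ker ↔ s x = x := by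
    intro x; rw [AddMonoidHom.mem_ker, hd, sub_eq_zero]
  obtain ⟨H0, H1⟩ := herbrand_index d n hdn hnd
  -- p-torsion counting
  have tors : ∀ A : AddSubgroup M, Nat.card (nsmulAddMonoidHom p : A →+ A).ker ≤ p := by
    intro A
    refine le_trans ?_ ht
    refine Nat.card_le_card_of_injective
      (fun x => (⟨x.1.1, congrArg Subtype.val (show p • x.1 = 0 from x.2)⟩ :
        (nsmulAddMonoidHom p : M →+ M).ker)) ?_
    intro x y h
    exact Subtype.ext (Subtype.ext (congrArg (fun z : (nsmulAddMonoidHom p : M →+ M).ker => z.1) h))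
  have a_eq : (d.ker.map n).relIndex d.ker = (nsmulAddMonoidHom p : d.ker →+ d.ker).range.index := by
    rw [AddSubgroup.relIndex]
    congr 1
    ext x
    rw [AddSubgroup.mem_addSubgroupOf, AddSubgroup.mem_map, AddMonoidHom.mem_range]
    constructor
    · rintro ⟨y, hy, h⟩
      refine ⟨⟨y, hy⟩, Subtype.ext ?_⟩
      rw [← h, hfix y ((hker y).1 hy)]; rfl
    · rintro ⟨y, rfl⟩
      exact ⟨y.1, y.2, hfix y.1 ((hker _).1 y.2)⟩
  have a_le : (d.ker.map n).relIndex d.ker ≤ p ^ (Module.finrank ℤ d.ker + 1) := by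
    rw [a_eq, index_nsmul_range p hp.ne_zero, pow_succ]
    exact Nat.mul_le_mul_left _ (tors _)
  have fin_ker : ∀ A : AddSubgroup M, Finite (nsmulAddMonoidHom p : A →+ A).ker := by
    intro A
    refine Finite.of_injective
      (fun x => (⟨x.1.1, congrArg Subtype.val (show p • x.1 = 0 from x.2)⟩ :
        (nsmulAddMonoidHom p : M →+ M).ker)) ?_
    intro x y h
    exact Subtype.ext (Subtype.ext (congrArg (fun z : (nsmulAddMonoidHom p : M →+ M).ker => z.1) h))
  have a_ne : (d.ker.map n).relIndex d.ker ≠ 0 := by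
    rw [a_eq, index_nsmul_range p hp.ne_zero]
    have := fin_ker d.ker
    exact mul_ne_zero (pow_ne_zero _ hp.ne_zero) Nat.card_pos.ne'
  -- norm kernel
  let s' : AddMonoid.End n.ker :=
    { toFun := fun x => ⟨s x.1, by rw [AddMonoidHom.mem_ker, hns]; exact x.2⟩
      map_zero' := by ext; exact map_zero s
      map_add' := fun x y => by ext; exact map_add s _ _ }
  have hs'i : ∀ i (x : n.ker), ((s' ^ i) x).1 = (s ^ i) x.1 := by
    intro i
    induction i with
    | zero => intro x; rfl
    | succ i ih =>
      intro x
      rw [pow_succ, pow_succ]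
      change ((s' ^ i) (s' x)).1 = (s ^ i) (s x.1)
      rw [ih]; rfl
  have hN' : ∑ i ∈ Finset.range p, s' ^ i = 0 := by
    ext x
    have e : (∑ i ∈ Finset.range p, s' ^ i) x = ∑ i ∈ Finset.range p, (s' ^ i) x :=
      AddMonoidHom.finsetSum_apply _ _ _
    rw [e, AddSubgroup.val_finsetSum]
    simp only [hs'i]
    rw [← hn]; exact x.2
  have b_eq : (n.ker.map d).relIndex n.ker = (rg (s' - 1)).index := by
    rw [AddSubgroup.relIndex]
    congr 1
    ext x
    rw [AddSubgroup.mem_addSubgroupOf, AddSubgroup.mem_map, mem_rg]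
    constructor
    · rintro ⟨y, hy, h⟩
      refine ⟨⟨y, hy⟩, Subtype.ext ?_⟩
      rw [← h, hd]; rfl
    · rintro ⟨y, rfl⟩
      exact ⟨y.1, y.2, hd y.1⟩
  obtain ⟨D1, D2⟩ := index_norm_zero p hp s' hN'
  have cardp : Nat.card (nsmulAddMonoidHom p : n.ker →+ n.ker).ker = p := by
    apply le_antisymm (tors _)
    have := fin_ker n.ker
    have hzn : z ∈ n.ker := by rw [AddMonoidHom.mem_ker, hfix z hsz, hpz]
    let zz : (nsmulAddMonoidHom p : n.ker →+ n.ker).ker := ⟨⟨z, hzn⟩, Subtype.ext hpz⟩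
    have ho : addOrderOf zz = p := by
      have := Fact.mk hp
      apply addOrderOf_eq_prime
      · exact Subtype.ext (Subtype.ext hpz)
      · intro h
        exact hz0 (congrArg (fun t => t.1.1) h)
    have := addOrderOf_dvd_natCard zz
    rw [ho] at this
    exact Nat.le_of_dvd Nat.card_pos this
  rw [index_nsmul_range p hp.ne_zero, cardp, ← pow_succ] at D1 D2
  obtain ⟨k, -, hbk⟩ := (Nat.dvd_prime_pow hp).1 D2
  rw [hbk, ← pow_mul] at D1
  have hk' : Module.finrank ℤ n.ker + 1 ≤ k * (p - 1) :=
    (Nat.pow_dvd_pow_iff_le_right hp.one_lt).1 D1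
  have hrn : Module.finrank ℤ M ≤ Module.finrank ℤ d.ker + Module.finrank ℤ n.ker := by
    rw [← finrank_addSubgroup_range_ker n]
    apply Nat.add_le_add_right
    apply finrank_addSubgroup_mono
    rintro _ ⟨x, rfl⟩
    exact hdn x
  have hfin := finrank_p_arith p _ _ _ k hodd hr hk.le hrn hk'
  have hab : p * (d.ker.map n).relIndex d.ker ≤ (n.ker.map d).relIndex n.ker := by
    rw [b_eq, hbk]
    calc _ ≤ p * p ^ (Module.finrank ℤ d.ker + 1) := Nat.mul_le_mul_left _ a_le
      _ = p ^ (Module.finrank ℤ d.ker + 2) := by ring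
      _ ≤ p ^ k := Nat.pow_le_pow_right hp.pos hfin
  rw [← H0] at a_ne
  have hX := left_ne_zero_of_mul a_ne
  refine ⟨?_, right_ne_zero_of_mul a_ne⟩
  rw [← H0, ← H1] at hab
  refine Nat.le_of_mul_le_mul_left ?_ (Nat.pos_of_ne_zero hX)
  calc _ = p * ((d.ker ⊔ n.ker).index * n.range.relIndex d.ker) := by ring
    _ ≤ _ := hab

end BlockA

section BlockB

open UniqueFactorizationMonoid
open scoped Pointwise

section PartB

set_option linter.unusedSectionVars false
set_option linter.unusedVariables false

variable {A B : Type*} [CommRing A] [IsDedekindDomain A] [CommRing B] [IsDedekindDomain B]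

/-- multiplicity of an ideal in another -/
noncomputable def mu (P I : Ideal B) : ℕ := by
  classical exact (normalizedFactors I).count P

theorem mu_mul (P : Ideal B) {I J : Ideal B} (hI : I ≠ ⊥) (hJ : J ≠ ⊥) :
    mu P (I * J) = mu P I + mu P J := by
  classical
  simp [mu, normalizedFactors_mul hI hJ]

theorem mu_pow (P : Ideal B) {I : Ideal B} (n : ℕ) :
    mu P (I ^ n) = n * mu P I := by
  classical
  simp [mu, normalizedFactors_pow]

theorem mu_top (P : Ideal B) : mu P (⊤ : Ideal B) = 0 := by
  classical
  have : normalizedFactors (1 : Ideal B) = 0 := normalizedFactors_one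
  unfold mu
  rw [← Ideal.one_eq_top, this]
  rfl

theorem mu_pos_iff {P I : Ideal B} (hP : P.IsPrime) (hP0 : P ≠ ⊥) (hI : I ≠ ⊥) :
    0 < mu P I ↔ I ≤ P := by
  classical
  unfold mu
  rw [Multiset.count_pos, Ideal.mem_normalizedFactors_iff hI]
  exact ⟨fun h => h.2, fun h => ⟨hP, h⟩⟩

theorem dvd_of_mu_le {I J : Ideal B} (hI : I ≠ ⊥) (hJ : J ≠ ⊥)
    (h : ∀ P : Ideal B, P.IsPrime → P ≠ ⊥ → mu P I ≤ mu P J) : I ∣ J := by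
  classical
  rw [dvd_iff_normalizedFactors_le_normalizedFactors hI hJ, Multiset.le_iff_count]
  intro P
  by_cases hP : P ∈ normalizedFactors I
  · have h1 := prime_of_normalized_factor P hP
    exact h P (Ideal.isPrime_of_prime h1) h1.ne_zero
  · simp [Multiset.count_eq_zero_of_notMem hP]

theorem eq_of_mu_eq {I J : Ideal B} (hI : I ≠ ⊥) (hJ : J ≠ ⊥)
    (h : ∀ P : Ideal B, P.IsPrime → P ≠ ⊥ → mu P I = mu P J) : I = J :=
  dvd_antisymm' (dvd_of_mu_le hJ hI fun P a b => (h P a b).ge)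
    (dvd_of_mu_le hI hJ fun P a b => (h P a b).le)

variable {G : Type*} [Group G] [MulSemiringAction G B]

theorem smul_ideal_mul (g : G) (I J : Ideal B) : g • (I * J) = (g • I) * (g • J) := by
  simp only [Ideal.pointwise_smul_def, Ideal.map_mul]

theorem smul_ideal_pow (g : G) (I : Ideal B) (n : ℕ) : g • (I ^ n) = (g • I) ^ n := by
  simp only [Ideal.pointwise_smul_def, Ideal.map_pow]

theorem smul_ideal_span (g : G) (x : B) : g • (Ideal.span {x}) = Ideal.span {g • x} := by
  simp only [Ideal.pointwise_smul_def, Ideal.map_span, Set.image_singleton]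
  rfl

theorem smul_ideal_bot (g : G) : g • (⊥ : Ideal B) = ⊥ := by
  simp only [Ideal.pointwise_smul_def, Ideal.map_bot]

theorem smul_ideal_ne_bot (g : G) {I : Ideal B} (hI : I ≠ ⊥) : g • I ≠ ⊥ := by
  intro h
  apply hI
  have := congrArg (g⁻¹ • ·) h
  simpa [smul_ideal_bot] using this

/-- the multiplicative automorphism of ideals -/
def smulIdealEquiv (g : G) : Ideal B ≃* Ideal B where
  toFun I := g • I
  invFun I := g⁻¹ • I
  left_inv I := by simp
  right_inv I := by simp
  map_mul' := smul_ideal_mul g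

theorem mu_smul (g : G) {P I : Ideal B} (hP : P.IsPrime) (hP0 : P ≠ ⊥) (hI : I ≠ ⊥) :
    mu (g • P) (g • I) = mu P I := by
  classical
  have key : ∀ Q J : Ideal B, Q.IsPrime → Q ≠ ⊥ → J ≠ ⊥ → emultiplicity Q J = mu Q J := by
    intro Q J hQ hQ0 hJ
    have := emultiplicity_eq_count_normalizedFactors (Ideal.prime_of_isPrime hQ0 hQ).irreducible hJ
    rw [this, normalize_eq]; rfl
  have h1 := key P I hP hP0 hI
  have h2 := key (g • P) (g • I) (Ideal.map_isPrime_of_equiv (MulSemiringAction.toRingEquiv G B g)) (smul_ideal_ne_bot g hP0) (smul_ideal_ne_bot g hI)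
  have h3 : emultiplicity (g • P) (g • I) = emultiplicity P I :=
    emultiplicity_map_eq (smulIdealEquiv g)
  rw [h1, h2] at h3
  exact_mod_cast h3

theorem mu_smul_of_invariant (g : G) {P I : Ideal B} (hP : P.IsPrime) (hP0 : P ≠ ⊥) (hI : I ≠ ⊥)
    (h : g • I = I) : mu (g • P) I = mu P I := by
  rw [← mu_smul g hP hP0 hI, h]

variable [Algebra A B] [FaithfulSMul A B] [Algebra.IsIntegral A B]

theorem map_ne_bot {J : Ideal A} (hJ : J ≠ ⊥) : J.map (algebraMap A B) ≠ ⊥ := by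
  intro h
  exact hJ ((Ideal.map_eq_bot_iff_of_injective (FaithfulSMul.algebraMap_injective A B)).1 h)

theorem under_ne_bot {P : Ideal B} (hP0 : P ≠ ⊥) : P.under A ≠ ⊥ :=
  Ideal.IsIntegral.comap_ne_bot A hP0

theorem mu_map_under {P : Ideal B} (hP0 : P ≠ ⊥) :
    mu P ((P.under A).map (algebraMap A B)) = P.ramificationIdx A := by
  classical
  rw [Ideal.IsDedekindDomain.ramificationIdx_eq_normalizedFactors_count (P.under A) P
    (map_ne_bot (under_ne_bot hP0))]
  rfl

theorem mu_map_ne {P : Ideal B} (hP : P.IsPrime) (hP0 : P ≠ ⊥) {q : Ideal A} (hq : q.IsPrime)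
   (hq0 : q ≠ ⊥) (h : q ≠ P.under A) : mu P (q.map (algebraMap A B)) = 0 := by
  by_contra h0
  have h1 := (mu_pos_iff hP hP0 (map_ne_bot hq0)).1 (Nat.pos_of_ne_zero h0)
  rw [Ideal.map_le_iff_le_comap] at h1
  exact h ((hq.isMaximal hq0).eq_of_le (Ideal.comap_ne_top _ hP.ne_top) h1)

variable [IsGaloisGroup G A B] 

theorem smul_map (g : G) (J : Ideal A) : g • (J.map (algebraMap A B)) = J.map (algebraMap A B) := by
  rw [Ideal.pointwise_smul_def, Ideal.map_map]
  congr 1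
  ext x
  simp only [RingHom.coe_comp, Function.comp_apply, MulSemiringAction.toRingHom_apply]
  have := IsGaloisGroup.commutes (G := G) (A := A) (B := B)
  exact smul_algebraMap g x


theorem smul_cancel (g : G) {I J : Ideal B} (hJ0 : J ≠ ⊥) (hJ : g • J = J) (h : g • (J * I) = J * I) :
    g • I = I := by
  rw [smul_ideal_mul, hJ] at h
  exact mul_left_cancel₀ hJ0 h

variable (A G) in
theorem lemmaR [Finite G] (I : Ideal B) (hI : I ≠ ⊥) (hinv : ∀ g : G, g • I = I)
    (hdvd : ∀ P : Ideal B, P.IsPrime → P ≠ ⊥ → P.ramificationIdx A ∣ mu P I) :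
    ∃ J : Ideal A, J ≠ ⊥ ∧ I = J.map (algebraMap A B) := by
  induction I using WellFoundedGT.induction with
  | ind I ih =>
  by_cases htop : I = ⊤
  · exact ⟨⊤, by simp, by simp [htop, Ideal.map_top]⟩
  obtain ⟨P, hPm, hPI⟩ := Ideal.exists_le_maximal I htop
  have hP := hPm.isPrime
  have hP0 : P ≠ ⊥ := ne_bot_of_le_ne_bot hI hPI
  set q := P.under A with hq
  have hqp : q.IsPrime := Ideal.IsPrime.under A P
  have hq0 : q ≠ ⊥ := under_ne_bot hP0
  have hmq := map_ne_bot (B := B) hq0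
  have hdv : q.map (algebraMap A B) ∣ I := by
    refine dvd_of_mu_le hmq hI fun Q hQ hQ0 => ?_
    by_cases hQq : q = Q.under A
    · have : Q.LiesOver q := ⟨hQq⟩
      have : P.LiesOver q := ⟨hq⟩
      obtain ⟨g, rfl⟩ := Ideal.exists_smul_eq_of_isGaloisGroup q P Q G
      have h1 := hdvd _ hQ hQ0
      rw [hQq, mu_map_under hQ0]
      apply Nat.le_of_dvd _ h1
      rw [mu_smul_of_invariant g hP hP0 hI (hinv g)]
      exact (mu_pos_iff hP hP0 hI).2 hPI
    · rw [mu_map_ne hQ hQ0 hqp hq0 hQq]; exact Nat.zero_le _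
  obtain ⟨I', rfl⟩ := hdv
  have hI' : I' ≠ ⊥ := by rintro rfl; simp at hI
  obtain ⟨J, hJ0, hJ⟩ := ih I' (by
    rw [lt_iff_le_and_ne]
    refine ⟨Ideal.mul_le_right, fun h => ?_⟩
    have h2 : q.map (algebraMap A B) * I' = 1 * I' := by rw [h, one_mul]
    have h3 := mul_right_cancel₀ hI' h2
    have h4 : q.map (algebraMap A B) ≤ P := Ideal.map_comap_le
    rw [h3, Ideal.one_eq_top, top_le_iff] at h4
    exact hP.ne_top h4) hI' (fun g => smul_cancel g hmq (smul_map g q) (hinv g)) (by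
    intro Q hQ hQ0
    have h1 := hdvd Q hQ hQ0
    rw [mu_mul Q hmq hI'] at h1
    refine (Nat.dvd_add_right ?_).1 h1
    by_cases hQq : q = Q.under A
    · rw [hQq, mu_map_under hQ0]
    · rw [mu_map_ne hQ hQ0 hqp hq0 hQq]; exact dvd_zero _)
  exact ⟨q * J, mul_ne_zero hq0 hJ0, by rw [Ideal.map_mul, ← hJ]⟩


theorem ram_cases [Finite G] [Module.Finite A B] {p : ℕ} (hp : p.Prime) (hG : Nat.card G = p)
    {P : Ideal B} (hP : P.IsPrime) (hP0 : P ≠ ⊥) :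
    P.ramificationIdx A = 1 ∨ (P.ramificationIdx A = p ∧ ∀ g : G, g • P = P) := by
  have hq0 : P.under A ≠ ⊥ := under_ne_bot hP0
  have hqp : (P.under A).IsPrime := Ideal.IsPrime.under A P
  have hmax := hqp.isMaximal hq0
  have h := Ideal.ncard_primesOver_mul_ramificationIdxIn_mul_inertiaDegIn (P.under A) B G
  rw [Ideal.ramificationIdxIn_eq_ramificationIdx (P.under A) P G, hG] at h
  have h1 : P.ramificationIdx A ∣ p := ⟨((P.under A).primesOver B).ncard * (P.under A).inertiaDegIn B,
    by rw [← h]; ring⟩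
  rcases (Nat.dvd_prime hp).1 h1 with h2 | h2
  · exact Or.inl h2
  refine Or.inr ⟨h2, ?_⟩
  rw [h2] at h
  have h3 : ((P.under A).primesOver B).ncard * (P.under A).inertiaDegIn B = 1 := by
    apply Nat.eq_of_mul_eq_mul_left hp.pos
    rw [mul_one]; nth_rw 2 [← h]; ring
  have h4 := Nat.eq_one_of_mul_eq_one_right h3
  obtain ⟨Q, hQ⟩ := Set.ncard_eq_one.1 h4
  have hPm : P ∈ (P.under A).primesOver B := ⟨hP, ⟨rfl⟩⟩
  intro g
  have hgm : g • P ∈ (P.under A).primesOver B := by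
    refine ⟨Ideal.map_isPrime_of_equiv (MulSemiringAction.toRingEquiv G B g), ⟨?_⟩⟩
    have := IsGaloisGroup.commutes (G := G) (A := A) (B := B)
    exact (Ideal.under_smul A P g).symm
  rw [hQ] at hPm hgm
  exact hgm.trans hPm.symm

theorem prod_ne_bot {ι : Type*} (s : Finset ι) (f : ι → Ideal B) (h : ∀ i, f i ≠ ⊥) :
    ∏ i ∈ s, f i ≠ ⊥ := by
  rw [← Ideal.zero_eq_bot, Finset.prod_ne_zero_iff]
  exact fun i _ => h i

theorem mu_prod (P : Ideal B) {ι : Type*} (s : Finset ι) (f : ι → Ideal B) (h : ∀ i, f i ≠ ⊥) :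
    mu P (∏ i ∈ s, f i) = ∑ i ∈ s, mu P (f i) := by
  classical
  induction s using Finset.induction_on with
  | empty => simpa using mu_top P
  | insert a s ha ih => rw [Finset.prod_insert ha, Finset.sum_insert ha,
      mu_mul P (h a) (prod_ne_bot s f h), ih]

variable (A G) in
theorem norm_ideal [Fintype G] [Module.Finite A B] {p : ℕ} (hp : p.Prime) (hG : Nat.card G = p)
    (I : Ideal B) (hI : I ≠ ⊥) :
    ∃ J : Ideal A, J ≠ ⊥ ∧ ∏ g : G, g • I = J.map (algebraMap A B) := by
  apply lemmaR A G
  · exact prod_ne_bot _ _ fun g => smul_ideal_ne_bot g hI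
  · intro g
    have : g • ∏ h : G, h • I = ∏ h : G, g • (h • I) := map_prod (smulIdealEquiv g) _ _
    rw [this]
    refine Fintype.prod_bijective (fun h => g * h) (Group.mulLeft_bijective g) _ _ fun h => ?_
    rw [mul_smul]
  · intro P hP hP0
    rcases ram_cases (A := A) hp hG hP hP0 with h | ⟨h, h2⟩
    · rw [h]; exact one_dvd _
    · rw [h, mu_prod _ _ _ fun g => smul_ideal_ne_bot g hI]
      have : ∀ g : G, mu P (g • I) = mu P I := fun g => by
        rw [← mu_smul g hP hP0 hI, h2 g]
      simp only [this, Finset.sum_const, Finset.card_univ, ← Nat.card_eq_fintype_card, hG,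
        smul_eq_mul]
      exact dvd_mul_right _ _

variable (A G) in
/-- two invariant ideals with the same ramified valuations mod p differ by ideals from below -/
theorem inv_compare [Finite G] [Module.Finite A B] {p : ℕ} (hp : p.Prime) (hG : Nat.card G = p)
    (S : Set (Ideal A)) (rep : Ideal A → Ideal B)
    (hrep : ∀ q ∈ S, (rep q).IsPrime ∧ (rep q) ≠ ⊥ ∧ (rep q).under A = q)
    (hS : ∀ P : Ideal B, P.IsPrime → P ≠ ⊥ → P.under A ∉ S → P.ramificationIdx A = 1)
    (I I' : Ideal B) (hI : I ≠ ⊥) (hI' : I' ≠ ⊥) (hinv : ∀ g : G, g • I = I)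
    (hinv' : ∀ g : G, g • I' = I')
    (h : ∀ q ∈ S, ((mu (rep q) I : ℕ) : ZMod p) = (mu (rep q) I' : ℕ)) :
    ∃ J J' : Ideal A, J ≠ ⊥ ∧ J' ≠ ⊥ ∧
      I * J.map (algebraMap A B) = I' * J'.map (algebraMap A B) := by
  have : Fact p.Prime := ⟨hp⟩
  have mm : ∀ I₁ : Ideal B, I₁ ≠ ⊥ → (∀ g : G, g • I₁ = I₁) →
      (∀ q ∈ S, ((mu (rep q) I₁ : ℕ) : ZMod p) = 0) →
      ∃ J : Ideal A, J ≠ ⊥ ∧ I₁ = J.map (algebraMap A B) := by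
    intro I₁ h0 hi hv
    apply lemmaR A G I₁ h0 hi
    intro P hP hP0
    rcases ram_cases (A := A) hp hG hP hP0 with h | ⟨h, h2⟩
    · rw [h]; exact one_dvd _
    by_cases hPS : P.under A ∈ S
    · obtain ⟨r1, r2, r3⟩ := hrep _ hPS
      have : P.LiesOver (P.under A) := ⟨rfl⟩
      have : (rep (P.under A)).LiesOver (P.under A) := ⟨r3.symm⟩
      obtain ⟨g, hg⟩ := Ideal.exists_smul_eq_of_isGaloisGroup (P.under A) P (rep (P.under A)) G
      rw [h2] at hg
      have := hv _ hPS
      rw [← hg, ZMod.natCast_eq_zero_iff] at this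
      rwa [h]
    · rw [hS P hP hP0 hPS]; exact one_dvd _
  obtain ⟨J', hJ', e'⟩ := mm (I * I' ^ (p - 1)) (mul_ne_zero hI (pow_ne_zero _ hI'))
    (fun g => by rw [smul_ideal_mul, smul_ideal_pow, hinv, hinv']) (by
      intro q hq
      rw [mu_mul _ hI (pow_ne_zero _ hI'), mu_pow]
      push_cast
      rw [h q hq, Nat.cast_sub hp.one_le]
      simp)
  obtain ⟨J, hJ, e⟩ := mm (I' ^ p) (pow_ne_zero _ hI')
    (fun g => by rw [smul_ideal_pow, hinv']) (by
      intro q hq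
      rw [mu_pow]
      simp)
  refine ⟨J, J', hJ, hJ', ?_⟩
  rw [← e, ← e']
  obtain ⟨m, rfl⟩ : ∃ m, p = m + 1 := ⟨p - 1, by have := hp.pos; omega⟩
  simp only [Nat.add_sub_cancel]
  ring

end PartB

end BlockB

section BlockC1

open UniqueFactorizationMonoid
open scoped Pointwise nonZeroDivisors

section PartC1
set_option linter.unusedSectionVars false
set_option linter.unusedVariables false

variable {B : Type*} [CommRing B] [IsDedekindDomain B]

open Classical in
/-- the class of a nonzero ideal -/
noncomputable def cls (I : Ideal B) : ClassGroup B :=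
  if h : I ≠ ⊥ then ClassGroup.mk0 ⟨I, mem_nonZeroDivisors_of_ne_zero h⟩ else 1

theorem cls_eq {I : Ideal B} (h : I ≠ ⊥) :
    cls I = ClassGroup.mk0 ⟨I, mem_nonZeroDivisors_of_ne_zero h⟩ := dif_pos h

theorem cls_mul {I J : Ideal B} (hI : I ≠ ⊥) (hJ : J ≠ ⊥) : cls (I * J) = cls I * cls J := by
  rw [cls_eq hI, cls_eq hJ, cls_eq (mul_ne_zero hI hJ), ← map_mul]
  rfl

theorem cls_one : cls (1 : Ideal B) = 1 := by
  have h : (1 : Ideal B) ≠ ⊥ := one_ne_zero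
  rw [cls_eq h]
  exact map_one ClassGroup.mk0

theorem cls_pow {I : Ideal B} (hI : I ≠ ⊥) (n : ℕ) : cls (I ^ n) = cls I ^ n := by
  induction n with
  | zero => rw [pow_zero, pow_zero, cls_one]
  | succ n ih => rw [pow_succ, pow_succ, cls_mul (pow_ne_zero n hI) hI, ih]

theorem cls_prod {ι : Type*} (s : Finset ι) (f : ι → Ideal B) (h : ∀ i, f i ≠ ⊥) :
    cls (∏ i ∈ s, f i) = ∏ i ∈ s, cls (f i) := by
  classical
  induction s using Finset.induction_on with
  | empty => simpa using cls_one
  | insert a s ha ih => rw [Finset.prod_insert ha, Finset.prod_insert ha,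
      cls_mul (h a) (prod_ne_bot s f h), ih]

theorem cls_surj (c : ClassGroup B) : ∃ I : Ideal B, I ≠ ⊥ ∧ cls I = c := by
  obtain ⟨⟨I, hI⟩, rfl⟩ := ClassGroup.mk0_surjective c
  have : I ≠ ⊥ := nonZeroDivisors.ne_zero hI
  exact ⟨I, this, cls_eq this⟩

theorem cls_eq_iff {I J : Ideal B} (hI : I ≠ ⊥) (hJ : J ≠ ⊥) :
    cls I = cls J ↔ ∃ x y : B, x ≠ 0 ∧ y ≠ 0 ∧ Ideal.span {x} * I = Ideal.span {y} * J := by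
  rw [cls_eq hI, cls_eq hJ, ClassGroup.mk0_eq_mk0_iff]
  constructor
  · rintro ⟨x, y, a, b, c⟩; exact ⟨x, y, a, b, c⟩
  · rintro ⟨x, y, a, b, c⟩; exact ⟨x, y, a, b, c⟩

theorem span_ne_bot {x : B} (hx : x ≠ 0) : Ideal.span {x} ≠ (⊥ : Ideal B) := by
  rwa [Ne, Ideal.span_singleton_eq_bot]

theorem cls_span {x : B} (hx : x ≠ 0) : cls (Ideal.span {x}) = 1 := by
  rw [← cls_one, cls_eq_iff (span_ne_bot hx) one_ne_zero]
  refine ⟨1, x, one_ne_zero, hx, ?_⟩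
  rw [mul_one, Ideal.span_singleton_one, ← Ideal.one_eq_top, one_mul]

theorem cls_eq_one_iff {I : Ideal B} (hI : I ≠ ⊥) :
    cls I = 1 ↔ ∃ x : B, x ≠ 0 ∧ I = Ideal.span {x} := by
  constructor
  · intro h
    rw [cls_eq hI, ClassGroup.mk0_eq_one_iff] at h
    obtain ⟨x, hx⟩ := h.principal
    refine ⟨x, ?_, hx⟩
    rintro rfl
    apply hI
    rw [hx]
    simp
  · rintro ⟨x, hx, rfl⟩; exact cls_span hx

variable {G : Type*} [Group G] [MulSemiringAction G B]

theorem smul_cls_eq (g : G) {I J : Ideal B} (hI : I ≠ ⊥) (hJ : J ≠ ⊥) (h : cls I = cls J) :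
    cls (g • I) = cls (g • J) := by
  obtain ⟨x, y, hx, hy, e⟩ := (cls_eq_iff hI hJ).1 h
  rw [cls_eq_iff (smul_ideal_ne_bot g hI) (smul_ideal_ne_bot g hJ)]
  refine ⟨g • x, g • y, ?_, ?_, ?_⟩
  · rwa [Ne, smul_eq_zero_iff_eq]
  · rwa [Ne, smul_eq_zero_iff_eq]
  · rw [← smul_ideal_span, ← smul_ideal_span, ← smul_ideal_mul, ← smul_ideal_mul, e]

/-- the action on the class group -/
noncomputable def sig (g : G) : ClassGroup B →* ClassGroup B where
  toFun c := cls (g • (cls_surj c).choose)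
  map_one' := by
    rw [smul_cls_eq g (cls_surj 1).choose_spec.1 (J := 1) one_ne_zero
      ((cls_surj 1).choose_spec.2.trans cls_one.symm)]
    have : g • (1 : Ideal B) = 1 := map_one (smulIdealEquiv g)
    rw [this, cls_one]
  map_mul' x y := by
    have hx := (cls_surj x).choose_spec
    have hy := (cls_surj y).choose_spec
    have hxy := (cls_surj (x * y)).choose_spec
    rw [smul_cls_eq g hxy.1 (J := (cls_surj x).choose * (cls_surj y).choose)
      (mul_ne_zero hx.1 hy.1) (by rw [hxy.2, cls_mul hx.1 hy.1, hx.2, hy.2]),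
      smul_ideal_mul, cls_mul (smul_ideal_ne_bot g hx.1) (smul_ideal_ne_bot g hy.1)]

theorem sig_cls (g : G) {I : Ideal B} (hI : I ≠ ⊥) : sig g (cls I) = cls (g • I) :=
  smul_cls_eq g (cls_surj (cls I)).choose_spec.1 hI (cls_surj (cls I)).choose_spec.2

theorem sig_iterate (g : G) {I : Ideal B} (hI : I ≠ ⊥) (n : ℕ) :
    (sig g)^[n] (cls I) = cls (g ^ n • I) := by
  induction n with
  | zero => simp
  | succ n ih => rw [Function.iterate_succ_apply', ih, sig_cls g (smul_ideal_ne_bot _ hI),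
      smul_smul, pow_succ']

variable {A : Type*} [CommRing A] [IsDedekindDomain A] [Algebra A B] [FaithfulSMul A B]

variable (B) in
theorem ext_pow_principal [Finite (ClassGroup A)] {J : Ideal A} (hJ : J ≠ ⊥) :
    ∃ x : A, x ≠ 0 ∧
      (J.map (algebraMap A B)) ^ Nat.card (ClassGroup A) = Ideal.span {algebraMap A B x} := by
  have h : cls (J ^ Nat.card (ClassGroup A)) = 1 := by
    rw [cls_pow hJ]
    exact pow_card_eq_one'
  obtain ⟨x, hx, e⟩ := (cls_eq_one_iff (pow_ne_zero _ hJ)).1 h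
  refine ⟨x, hx, ?_⟩
  rw [← Ideal.map_pow, e, Ideal.map_span, Set.image_singleton]

theorem ext_cls_pow [Finite (ClassGroup A)] {J : Ideal A} (hJ : J ≠ ⊥) :
    cls (J.map (algebraMap A B)) ^ Nat.card (ClassGroup A) = 1 := by
  have hm : J.map (algebraMap A B) ≠ ⊥ := fun h => 
    hJ ((Ideal.map_eq_bot_iff_of_injective (FaithfulSMul.algebraMap_injective A B)).1 h)
  obtain ⟨x, hx, e⟩ := ext_pow_principal B hJ
  rw [← cls_pow hm, e, cls_span]
  rwa [Ne, FaithfulSMul.algebraMap_eq_zero_iff]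

theorem eq_one_of_coprime_pow {C : Type*} [Group C] {c : C} {m n : ℕ} (h : m.Coprime n)
    (hm : c ^ m = 1) (hn : c ^ n = 1) : c = 1 := by
  have := pow_gcd_eq_one.2 ⟨hm, hn⟩
  rwa [Nat.Coprime.gcd_eq_one h, pow_one] at this

theorem card_le_fixed_mul (p : ℕ) (hp : p.Prime) {C : Type*} [CommGroup C] [Finite C]
    (s : C →* C)
    (hN : ∀ c : C, c ^ p = 1 → ∏ i ∈ Finset.range p, s^[i] c = 1) :
    Nat.card {c : C // c ^ p = 1} ≤ Nat.card {c : C // c ^ p = 1 ∧ s c = c} ^ (p - 1) := by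
  let V : Subgroup C := (powMonoidHom p : C →* C).ker
  have hV : ∀ c, c ∈ V ↔ c ^ p = 1 := fun c => Iff.rfl
  let sV : V →* V := (s.comp V.subtype).codRestrict V (fun x => by
    have := (hV _).1 x.2
    rw [hV]
    simp only [MonoidHom.comp_apply, Subgroup.subtype_apply]
    rw [← map_pow, this, map_one])
  let sa : AddMonoid.End (Additive V) := MonoidHom.toAdditive sV
  have hit : ∀ (i : ℕ) (w : Additive V), (((sa ^ i) w).toMul : C) = s^[i] (w.toMul : C) := by
    intro i
    induction i with
    | zero => intro w; rfl
    | succ i ih =>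
      intro w
      rw [Function.iterate_succ_apply, pow_succ]
      exact ih (sa w)
  have key := card_le_fixed_pow p hp sa (fun w => by
      apply Additive.toMul.injective
      apply Subtype.ext
      exact (hV _).1 w.toMul.2) (fun w => by
      apply Additive.toMul.injective
      apply Subtype.ext
      have := hN _ ((hV _).1 w.toMul.2)
      rw [toMul_sum, Subgroup.val_finsetProd]
      simp only [hit]
      exact this)
  have e1 : Nat.card (Additive V) = Nat.card {c : C // c ^ p = 1} := rfl
  have e2 : Nat.card (sa - 1).ker = Nat.card {c : C // c ^ p = 1 ∧ s c = c} := by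
    apply Nat.card_congr
    refine ⟨fun w => ⟨(w.1.toMul : C), (hV _).1 w.1.toMul.2, ?_⟩,
      fun c => ⟨Additive.ofMul (⟨c.1, (hV _).2 c.2.1⟩ : V), ?_⟩, ?_, ?_⟩
    · have h1 : sa w.1 - w.1 = 0 := w.2
      rw [sub_eq_zero] at h1
      exact congrArg (fun x : Additive V => (x.toMul : C)) h1
    · change sa _ - _ = 0
      rw [sub_eq_zero]
      apply Additive.toMul.injective
      apply Subtype.ext
      exact c.2.2
    · intro w; rfl
    · intro c; rfl
  rw [e1, e2] at key
  exact key

theorem prod_univ_eq_prod_range {G : Type*} [Group G] [Fintype G] {σ : G}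
    (hσ : ∀ g : G, g ∈ Subgroup.zpowers σ) {p : ℕ} (hG : Nat.card G = p) {M : Type*} [CommMonoid M]
    (f : G → M) : ∏ g : G, f g = ∏ i ∈ Finset.range p, f (σ ^ i) := by
  classical
  have ho : orderOf σ = p := by rw [orderOf_eq_card_of_forall_mem_zpowers hσ, hG]
  rw [← IsCyclic.image_range_card hσ, Finset.prod_image, hG]
  intro i hi j hj h
  rw [hG] at hi hj
  apply pow_injOn_Iio_orderOf (x := σ) _ _ h
  · rw [ho]; simpa using hi
  · rw [ho]; simpa using hj

variable (A) in
/-- Step 1 -/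
theorem card_torsion_le [Fintype G] [Algebra.IsIntegral A B] [Module.Finite A B]
    [IsGaloisGroup G A B] [Finite (ClassGroup A)] [Finite (ClassGroup B)] {p : ℕ} (hp : p.Prime)
    (hG : Nat.card G = p) {σ : G} (hσ : ∀ g : G, g ∈ Subgroup.zpowers σ)
    (hreg : ¬ p ∣ Nat.card (ClassGroup A)) :
    Nat.card {c : ClassGroup B // c ^ p = 1} ≤
      Nat.card {c : ClassGroup B // c ^ p = 1 ∧ sig σ c = c} ^ (p - 1) := by
  apply card_le_fixed_mul p hp
  intro c hc
  obtain ⟨I, hI, rfl⟩ := cls_surj c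
  simp only [sig_iterate σ hI]
  rw [← prod_univ_eq_prod_range hσ hG (fun g => cls (g • I))]
  obtain ⟨J, hJ, e⟩ := norm_ideal A G hp hG I hI
  have h1 : (∏ g : G, cls (g • I)) ^ Nat.card (ClassGroup A) = 1 := by
    rw [← cls_prod _ _ fun g => smul_ideal_ne_bot g hI, e, ext_cls_pow hJ]
  have h2 : (∏ g : G, cls (g • I)) ^ p = 1 := by
    rw [← Finset.prod_pow]
    apply Finset.prod_eq_one
    intro g _
    rw [← sig_cls g hI, ← map_pow, hc, map_one]
  exact eq_one_of_coprime_pow ((Nat.Prime.coprime_iff_not_dvd hp).2 hreg) h2 h1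

end PartC1

end BlockC1

section BlockC2

open UniqueFactorizationMonoid
open scoped Pointwise nonZeroDivisors

section PartC2
set_option linter.unusedSectionVars false
set_option linter.unusedVariables false

theorem index_le_of_rel_add {X Y : Type*} [AddCommGroup X] [AddCommGroup Y] (H X₀ : AddSubgroup X)
    (H' T : AddSubgroup Y) (hne : H'.relIndex T ≠ 0) (f : X → Y) (hf : ∀ x ∈ X₀, f x ∈ T)
    (h : ∀ x ∈ X₀, ∀ x' ∈ X₀, f x - f x' ∈ H' → x - x' ∈ H) : H.relIndex X₀ ≤ H'.relIndex T := by
  have hfi : (H'.addSubgroupOf T).FiniteIndex := ⟨hne⟩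
  have : Finite (T ⧸ H'.addSubgroupOf T) := AddSubgroup.finite_quotient_of_finiteIndex
  apply Nat.card_le_card_of_injective (f := fun q : X₀ ⧸ H.addSubgroupOf X₀ =>
    (QuotientAddGroup.mk (⟨f q.out, hf _ q.out.2⟩ : T) : T ⧸ H'.addSubgroupOf T))
  intro q q' hq
  have h1 := QuotientAddGroup.eq.1 hq.symm
  rw [AddSubgroup.mem_addSubgroupOf] at h1
  have h2 := h q.out q.out.2 q'.out q'.out.2 (by
    have : f q.out - f q'.out = -(f q'.out) + f q.out := by abel
    rw [this]; exact h1)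
  rw [← q.out_eq', ← q'.out_eq']
  symm
  refine QuotientAddGroup.eq.2 ?_
  rw [AddSubgroup.mem_addSubgroupOf]
  have : ((-q'.out + q.out : X₀) : X) = q.out - q'.out := by
    push_cast
    abel
  rw [this]; exact h2

theorem index_le_of_rel {X Y : Type*} [CommGroup X] [AddCommGroup Y] (H X₀ : Subgroup X)
    (H' T : AddSubgroup Y) (hne : H'.relIndex T ≠ 0) (f : X → Y) (hf : ∀ x ∈ X₀, f x ∈ T)
    (h : ∀ x ∈ X₀, ∀ x' ∈ X₀, f x - f x' ∈ H' → x / x' ∈ H) : H.relIndex X₀ ≤ H'.relIndex T :=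
  index_le_of_rel_add (X := Additive X) (Subgroup.toAddSubgroup H) (Subgroup.toAddSubgroup X₀)
    H' T hne f hf h

theorem mem_of_coprime_nsmul {X : Type*} [AddCommGroup X] (H : AddSubgroup X) {m n : ℕ}
    (hmn : m.Coprime n) {x : X} (hm : m • x ∈ H) (hn : n • x ∈ H) : x ∈ H := by
  have h := Nat.gcd_eq_gcd_ab m n
  rw [hmn.gcd_eq_one] at h
  have : x = (m.gcdA n) • (m • x) + (m.gcdB n) • (n • x) := by
    rw [← natCast_zsmul x m, ← natCast_zsmul x n, ← mul_zsmul', ← mul_zsmul', ← add_zsmul, ← h]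
    simp
  rw [this]
  exact H.add_mem (H.zsmul_mem hm _) (H.zsmul_mem hn _)

variable {A B : Type*} [CommRing A] [IsDedekindDomain A] [CommRing B] [IsDedekindDomain B]
  [Algebra A B] [FaithfulSMul A B] [Algebra.IsIntegral A B] [Module.Finite A B]
  {G : Type*} [Group G] [Fintype G] [MulSemiringAction G B] [IsGaloisGroup G A B]

/-- the action on units -/
def us (σ : G) : AddMonoid.End (Additive Bˣ) :=
  MonoidHom.toAdditive (Units.map (MulSemiringAction.toRingHom G B σ : B →* B))

theorem us_val (σ : G) (u : Additive Bˣ) : (((us σ u).toMul : Bˣ) : B) = σ • ((u.toMul : Bˣ) : B) :=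
  rfl

theorem us_pow (σ : G) (i : ℕ) (u : Additive Bˣ) :
    ((((us σ) ^ i) u).toMul : B) = σ ^ i • ((u.toMul : Bˣ) : B) := by
  induction i with
  | zero => simp
  | succ i ih =>
    rw [pow_succ', pow_succ', mul_smul, ← ih]
    exact us_val σ _

/-- the norm -/
def nm (σ : G) (p : ℕ) (a : B) : B := ∏ i ∈ Finset.range p, σ ^ i • a

/-- unit difference map -/
def ud (σ : G) : Additive Bˣ →+ Additive Bˣ := (show Additive Bˣ →+ Additive Bˣ from us σ) - AddMonoidHom.id _

/-- unit norm map -/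
def un (σ : G) (p : ℕ) : Additive Bˣ →+ Additive Bˣ := ∑ i ∈ Finset.range p, (us σ) ^ i

theorem ud_apply (σ : G) (x : Additive Bˣ) : ud σ x = us σ x - x := rfl

theorem un_apply (σ : G) (p : ℕ) (x : Additive Bˣ) :
    un σ p x = ∑ i ∈ Finset.range p, ((us σ) ^ i) x := by
  unfold un
  exact AddMonoidHom.finsetSum_apply _ _ _

theorem un_val (σ : G) (p : ℕ) (x : Additive Bˣ) : ((un σ p x).toMul : B) = nm σ p (x.toMul : B) := by
  rw [un_apply, toMul_sum, Units.coe_prod]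
  exact Finset.prod_congr rfl fun i _ => us_pow σ i x

theorem mem_ud_ker (σ : G) (x : Additive Bˣ) : x ∈ (ud σ : Additive Bˣ →+ Additive Bˣ).ker ↔ σ • (x.toMul : B) = x.toMul := by
  rw [AddMonoidHom.mem_ker, ud_apply, sub_eq_zero]
  constructor
  · intro h
    exact congrArg (fun u : Additive Bˣ => (u.toMul : B)) h
  · intro h
    apply Additive.toMul.injective
    exact Units.ext h

theorem nm_mul (σ : G) (p : ℕ) (a b : B) : nm σ p (a * b) = nm σ p a * nm σ p b := by
  simp only [nm, smul_mul', Finset.prod_mul_distrib]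

theorem nm_ne_zero (σ : G) (p : ℕ) {a : B} (h : a ≠ 0) : nm σ p a ≠ 0 := by
  rw [nm, Finset.prod_ne_zero_iff]
  intro i _
  rwa [Ne, smul_eq_zero_iff_eq]

theorem prod_range_shift {M : Type*} [CommMonoid M] (f : ℕ → M) (p : ℕ) (h : f p = f 0) :
    ∏ i ∈ Finset.range p, f (i + 1) = ∏ i ∈ Finset.range p, f i := by
  cases p with
  | zero => rfl
  | succ n => rw [Finset.prod_range_succ, Finset.prod_range_succ', h]

theorem smul_nm {σ : G} {p : ℕ} (hσp : σ ^ p = 1) (a : B) : σ • nm σ p a = nm σ p a := by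
  rw [nm, Finset.smul_prod']
  simp only [smul_smul, ← pow_succ']
  exact prod_range_shift (fun i => σ ^ i • a) p (by simp [hσp])

theorem nm_ideal_smul {σ : G} {p : ℕ} (hσp : σ ^ p = 1) (I : Ideal B) :
    ∏ i ∈ Finset.range p, σ ^ i • (σ • I) = ∏ i ∈ Finset.range p, σ ^ i • I := by
  simp only [smul_smul, ← pow_succ]
  exact prod_range_shift (fun i => σ ^ i • I) p (by simp [hσp])

theorem nm_ideal_span (σ : G) (p : ℕ) (a : B) :
    ∏ i ∈ Finset.range p, σ ^ i • Ideal.span {a} = Ideal.span {nm σ p a} := by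
  simp only [smul_ideal_span]
  rw [Ideal.prod_span_singleton, nm]

/-- units that are norms of elements -/
def unT (σ : G) (p : ℕ) : AddSubgroup (Additive Bˣ) where
  carrier := {u | u ∈ (ud σ).ker ∧ ∃ a b : B, a ≠ 0 ∧ b ≠ 0 ∧ nm σ p b = (u.toMul : B) * nm σ p a}
  zero_mem' := ⟨AddSubgroup.zero_mem _, 1, 1, one_ne_zero, one_ne_zero, by simp⟩
  add_mem' := by
    rintro u v ⟨h1, a, b, ha, hb, e⟩ ⟨h2, a', b', ha', hb', e'⟩
    refine ⟨AddSubgroup.add_mem _ h1 h2, a * a', b * b', mul_ne_zero ha ha', mul_ne_zero hb hb', ?_⟩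
    rw [nm_mul, nm_mul, e, e', toMul_add, Units.val_mul]
    ring
  neg_mem' := by
    rintro u ⟨h1, a, b, ha, hb, e⟩
    refine ⟨AddSubgroup.neg_mem _ h1, b, a, hb, ha, ?_⟩
    rw [e, ← mul_assoc, toMul_neg]
    simp

theorem mem_unT (σ : G) (p : ℕ) (u : Additive Bˣ) : u ∈ unT σ p ↔ u ∈ (ud σ).ker ∧
    ∃ a b : B, a ≠ 0 ∧ b ≠ 0 ∧ nm σ p b = (u.toMul : B) * nm σ p a := Iff.rfl

theorem unT_le (σ : G) (p : ℕ) : unT (B := B) σ p ≤ (ud σ).ker := fun u h => h.1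

theorem un_range_le {σ : G} {p : ℕ} (hσp : σ ^ p = 1) : (un (B := B) σ p).range ≤ unT σ p := by
  rintro _ ⟨x, rfl⟩
  refine ⟨?_, 1, x.toMul, one_ne_zero, x.toMul.ne_zero, ?_⟩
  · rw [mem_ud_ker, un_val, smul_nm hσp]
  · rw [un_val]
    simp [nm]

/-- the p-torsion invariant classes -/
def invC (B : Type*) [CommRing B] [IsDedekindDomain B] [MulSemiringAction G B] (σ : G) (p : ℕ) :
    Subgroup (ClassGroup B) where
  carrier := {c | c ^ p = 1 ∧ sig σ c = c}
  one_mem' := ⟨one_pow _, map_one _⟩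
  mul_mem' := by
    rintro x y ⟨a, b⟩ ⟨c, d⟩
    exact ⟨by rw [mul_pow, a, c, mul_one], by rw [map_mul, b, d]⟩
  inv_mem' := by
    rintro x ⟨a, b⟩
    exact ⟨by rw [inv_pow, a, inv_one], by rw [map_inv, b]⟩

/-- the classes with an invariant representative -/
def invC0 (B : Type*) [CommRing B] [IsDedekindDomain B] [MulSemiringAction G B] (σ : G) {p : ℕ}
    (hp : p.Prime) :
    Subgroup (ClassGroup B) where
  carrier := {c | c ^ p = 1 ∧ ∃ I : Ideal B, I ≠ ⊥ ∧ σ • I = I ∧ cls I = c}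
  one_mem' := ⟨one_pow _, 1, one_ne_zero, map_one (smulIdealEquiv σ), cls_one⟩
  mul_mem' := by
    rintro x y ⟨a, I, hI, b, rfl⟩ ⟨c, J, hJ, d, rfl⟩
    exact ⟨by rw [mul_pow, a, c, mul_one], I * J, mul_ne_zero hI hJ, by rw [smul_ideal_mul, b, d],
      cls_mul hI hJ⟩
  inv_mem' := by
    rintro x ⟨a, I, hI, b, rfl⟩
    refine ⟨by rw [inv_pow, a, inv_one], ?_⟩
    cases p with
    | zero => exact absurd hp Nat.not_prime_zero
    | succ n =>
      refine ⟨I ^ n, pow_ne_zero _ hI, by rw [smul_ideal_pow, b], ?_⟩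
      rw [cls_pow hI, eq_inv_iff_mul_eq_one, ← pow_succ, a]

theorem invC0_le (σ : G) {p : ℕ} (hp : p.Prime) : invC0 B σ hp ≤ invC B σ p := by
  rintro _ ⟨a, I, hI, b, rfl⟩
  exact ⟨a, by rw [sig_cls σ hI, b]⟩

theorem exists_int_inverse (A : Type*) [CommRing A] [IsDedekindDomain A] [Algebra A B]
    [FaithfulSMul A B] [Algebra.IsIntegral A B] [IsGaloisGroup G A B] (σ : G) (I : Ideal B) (hI : I ≠ ⊥) : ∃ (m : B) (I' : Ideal B), m ≠ 0 ∧ σ • m = m ∧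
    I' ≠ ⊥ ∧ I * I' = Ideal.span {m} := by
  obtain ⟨m, hm, hm0⟩ := Submodule.exists_mem_ne_zero_of_ne_bot (under_ne_bot (A := A) hI)
  have h1 : Ideal.span {algebraMap A B m} ≤ I := by
    rw [Ideal.span_singleton_le_iff_mem]; exact hm
  obtain ⟨I', h'⟩ := Ideal.dvd_iff_le.2 h1
  have := IsGaloisGroup.commutes (G := G) (A := A) (B := B)
  refine ⟨algebraMap A B m, I', by rwa [Ne, FaithfulSMul.algebraMap_eq_zero_iff],
    smul_algebraMap σ m, ?_, h'.symm⟩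
  rintro rfl
  rw [Ideal.mul_bot, Ideal.span_singleton_eq_bot, FaithfulSMul.algebraMap_eq_zero_iff] at h'
  exact hm0 h'

theorem claim1 {p : ℕ} (hp : p.Prime) {σ : G} (hσp : σ ^ p = 1)
    (h90 : ∀ a b : B, a ≠ 0 → b ≠ 0 → nm σ p a = nm σ p b → ∃ x : B, x ≠ 0 ∧ a * σ • x = b * x)
    (hinverse : ∀ I : Ideal B, I ≠ ⊥ → ∃ (m : B) (I' : Ideal B), m ≠ 0 ∧ σ • m = m ∧ I' ≠ ⊥ ∧
      I * I' = Ideal.span {m})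
    (hne : (un (B := B) σ p).range.relIndex (unT σ p) ≠ 0) :
    (invC0 B σ hp).relIndex (invC B σ p) ≤ (un (B := B) σ p).range.relIndex (unT σ p) := by
  classical
  let R : ClassGroup B → Additive Bˣ → Prop := fun c u => ∃ (I : Ideal B) (a b : B), I ≠ ⊥ ∧
    cls I = c ∧ a ≠ 0 ∧ b ≠ 0 ∧ Ideal.span {a} * σ • I = Ideal.span {b} * I ∧
    nm σ p b = (u.toMul : B) * nm σ p a
  have hex : ∀ c ∈ invC B σ p, ∃ u ∈ unT (B := B) σ p, R c u := by
    rintro c ⟨hc, hs⟩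
    obtain ⟨I, hI, rfl⟩ := cls_surj c
    rw [sig_cls σ hI, cls_eq_iff (smul_ideal_ne_bot σ hI) hI] at hs
    obtain ⟨a, b, ha, hb, e⟩ := hs
    have e2 : Ideal.span {nm σ p a} = Ideal.span {nm σ p b} := by
      have h1 : ∏ i ∈ Finset.range p, σ ^ i • (Ideal.span {a} * σ • I) =
          ∏ i ∈ Finset.range p, σ ^ i • (Ideal.span {b} * I) := by rw [e]
      simp only [smul_ideal_mul, Finset.prod_mul_distrib] at h1
      rw [nm_ideal_smul hσp, nm_ideal_span, nm_ideal_span] at h1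
      exact mul_right_cancel₀ (prod_ne_bot _ _ fun i => smul_ideal_ne_bot _ hI) h1
    rw [Ideal.span_singleton_eq_span_singleton] at e2
    obtain ⟨u, hu⟩ := e2
    have hu' : nm σ p b = ((Additive.ofMul u).toMul : B) * nm σ p a := by
      rw [← hu, toMul_ofMul, mul_comm]
    refine ⟨Additive.ofMul u, ⟨?_, a, b, ha, hb, hu'⟩, I, a, b, hI, rfl, ha, hb, e, hu'⟩
    rw [mem_ud_ker, toMul_ofMul]
    have h2 : σ • (nm σ p a * u) = nm σ p a * u := by rw [hu, smul_nm hσp]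
    rw [smul_mul', smul_nm hσp] at h2
    exact mul_left_cancel₀ (nm_ne_zero σ p ha) h2
  let f : ClassGroup B → Additive Bˣ := fun c => if h : c ∈ invC B σ p then (hex c h).choose else 0
  have hf : ∀ c (h : c ∈ invC B σ p), f c ∈ unT (B := B) σ p ∧ R c (f c) := by
    intro c h
    have : f c = (hex c h).choose := dif_pos h
    rw [this]
    exact (hex c h).choose_spec
  refine index_le_of_rel _ _ _ _ hne f (fun c h => (hf c h).1) ?_
  intro c hc c' hc' hd
  obtain ⟨w, hw⟩ := hd
  have hcc : c / c' ∈ invC B σ p := Subgroup.div_mem _ hc hc'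
  refine ⟨hcc.1, ?_⟩
  obtain ⟨I, a, b, hI, rfl, ha, hb, e, hn⟩ := (hf c hc).2
  obtain ⟨I', a', b', hI', rfl, ha', hb', e', hn'⟩ := (hf c' hc').2
  obtain ⟨m, I'', hm', hm, hI'', em⟩ := hinverse I' hI'
  have hw0 : (w.toMul : B) ≠ 0 := w.toMul.ne_zero
  have hN : nm σ p (b * a') = nm σ p (b' * a * w.toMul) := by
    rw [nm_mul, nm_mul, nm_mul, hn, hn', ← un_val]
    have : ((f (cls I)).toMul : B) = (un σ p w).toMul * (f (cls I')).toMul := by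
      have := eq_add_of_sub_eq hw.symm
      rw [this, toMul_add, Units.val_mul]
    rw [this]; ring
  obtain ⟨y, hy, ey⟩ := h90 _ _ (mul_ne_zero hb ha') (mul_ne_zero (mul_ne_zero hb' ha) hw0) hN
  have emσ : σ • I' * σ • I'' = Ideal.span {m} := by
    rw [← smul_ideal_mul, em, smul_ideal_span, hm]
  have hu : Ideal.span {(w.toMul : B)} = 1 := by
    rw [Ideal.one_eq_top, Ideal.span_singleton_eq_top]; exact w.toMul.isUnit
  have eyi : Ideal.span {b} * Ideal.span {a'} * Ideal.span {σ • y} =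
      Ideal.span {b'} * Ideal.span {a} * Ideal.span {y} := by
    have h1 := congrArg (fun t => Ideal.span {t}) ey
    simp only [← Ideal.span_singleton_mul_span_singleton, hu, mul_one] at h1
    exact h1
  refine ⟨Ideal.span {y} * (I * I''), mul_ne_zero (span_ne_bot hy) (mul_ne_zero hI hI''), ?_, ?_⟩
  · rw [smul_ideal_mul, smul_ideal_mul, smul_ideal_span]
    have hz : Ideal.span {a} * Ideal.span {b'} * Ideal.span {m} ≠ 0 :=
      mul_ne_zero (mul_ne_zero (span_ne_bot ha) (span_ne_bot hb')) (span_ne_bot hm')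
    apply mul_left_cancel₀ hz
    calc Ideal.span {a} * Ideal.span {b'} * Ideal.span {m} *
          (Ideal.span {σ • y} * (σ • I * σ • I''))
        = (Ideal.span {a} * σ • I) * (Ideal.span {b'} * I') * Ideal.span {σ • y} * I'' * σ • I'' := by
          rw [← em]; ring
      _ = (Ideal.span {b} * Ideal.span {a'} * Ideal.span {σ • y}) * I * (σ • I' * σ • I'') * I'' := by
          rw [e, ← e']; ring
      _ = _ := by rw [eyi, emσ]; ring
  · rw [cls_mul (span_ne_bot hy) (mul_ne_zero hI hI''), cls_span hy, one_mul, cls_mul hI hI'',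
      eq_div_iff_mul_eq', mul_assoc, mul_comm (cls I''), ← cls_mul hI' hI'', em, cls_span hm', mul_one]

end PartC2

end BlockC2

section BlockC3

open UniqueFactorizationMonoid
open scoped Pointwise nonZeroDivisors

section PartC3
set_option linter.unusedSectionVars false
set_option linter.unusedVariables false

variable {A B : Type*} [CommRing A] [IsDedekindDomain A] [CommRing B] [IsDedekindDomain B]
  [Algebra A B] [FaithfulSMul A B] [Algebra.IsIntegral A B] [Module.Finite A B]
  {G : Type*} [Group G] [Fintype G] [MulSemiringAction G B] [IsGaloisGroup G A B]

/-- the valuation vector mod p -/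
noncomputable def vv (p : ℕ) (S : Finset (Ideal A)) (rep : Ideal A → Ideal B) (I : Ideal B) :
    S → ZMod p := fun q => (mu (rep q.1) I : ℕ)

theorem vv_mul (p : ℕ) (S : Finset (Ideal A)) (rep : Ideal A → Ideal B) {I J : Ideal B}
    (hI : I ≠ ⊥) (hJ : J ≠ ⊥) : vv p S rep (I * J) = vv p S rep I + vv p S rep J := by
  ext q
  simp only [vv, mu_mul _ hI hJ, Pi.add_apply]
  push_cast; rfl

theorem vv_one (p : ℕ) (S : Finset (Ideal A)) (rep : Ideal A → Ideal B) :
    vv p S rep (1 : Ideal B) = 0 := by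
  ext q
  simp only [vv, Ideal.one_eq_top, mu_top, Pi.zero_apply]
  simp

theorem vv_pow (p : ℕ) (S : Finset (Ideal A)) (rep : Ideal A → Ideal B) {I : Ideal B}
    (hI : I ≠ ⊥) (n : ℕ) : vv p S rep (I ^ n) = n • vv p S rep I := by
  ext q
  simp only [vv, mu_pow, Pi.smul_apply]
  push_cast; simp

/-- valuation vectors of invariant principal ideals -/
noncomputable def QQ {p : ℕ} (hp : p.Prime) (S : Finset (Ideal A)) (rep : Ideal A → Ideal B)
    (σ : G) : AddSubgroup (S → ZMod p) where
  carrier := {v | ∃ β : B, β ≠ 0 ∧ σ • Ideal.span {β} = Ideal.span {β} ∧ vv p S rep (Ideal.span {β}) = v}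
  zero_mem' := ⟨1, one_ne_zero, by rw [smul_ideal_span, smul_one], by
    rw [Ideal.span_singleton_one, ← Ideal.one_eq_top, vv_one]⟩
  add_mem' := by
    rintro _ _ ⟨β, h0, h1, rfl⟩ ⟨γ, g0, g1, rfl⟩
    refine ⟨β * γ, mul_ne_zero h0 g0, ?_, ?_⟩
    · rw [← Ideal.span_singleton_mul_span_singleton, smul_ideal_mul, h1, g1]
    · rw [← Ideal.span_singleton_mul_span_singleton, vv_mul p S rep (span_ne_bot h0) (span_ne_bot g0)]
  neg_mem' := by
    rintro _ ⟨β, h0, h1, rfl⟩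
    refine ⟨β ^ (p - 1), pow_ne_zero _ h0, ?_, ?_⟩
    · rw [← Ideal.span_singleton_pow, smul_ideal_pow, h1]
    · rw [← Ideal.span_singleton_pow, vv_pow p S rep (span_ne_bot h0)]
      rw [eq_neg_iff_add_eq_zero, ← succ_nsmul, Nat.sub_add_cancel hp.one_le]
      ext q
      simp

theorem inv_all {σ : G} (hσ : ∀ g : G, g ∈ Subgroup.zpowers σ) {I : Ideal B} (h : σ • I = I) (g : G) :
    g • I = I := by
  have h1 : Subgroup.zpowers σ ≤ MulAction.stabilizer G I := by
    rw [Subgroup.zpowers_le]; exact h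
  exact h1 (hσ g)

theorem vv_compare {p : ℕ} (hp : p.Prime) (hG : Nat.card G = p) {σ : G}
    (hσ : ∀ g : G, g ∈ Subgroup.zpowers σ)
    (S : Finset (Ideal A)) (rep : Ideal A → Ideal B)
    (hrep : ∀ q ∈ S, (rep q).IsPrime ∧ (rep q) ≠ ⊥ ∧ (rep q).under A = q)
    (hS : ∀ P : Ideal B, P.IsPrime → P ≠ ⊥ → P.under A ∉ S → P.ramificationIdx A = 1)
    (I I' : Ideal B) (hI : I ≠ ⊥) (hI' : I' ≠ ⊥) (hinv : σ • I = I)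
    (hinv' : σ • I' = I') (h : vv p S rep I = vv p S rep I') :
    ∃ J J' : Ideal A, J ≠ ⊥ ∧ J' ≠ ⊥ ∧
      I * J.map (algebraMap A B) = I' * J'.map (algebraMap A B) :=
  inv_compare A G hp hG (S : Set (Ideal A)) rep (fun q hq => hrep q hq)
    (fun P hP hP0 h => hS P hP hP0 h) I I' hI hI' (inv_all hσ hinv) (inv_all hσ hinv')
    (fun q hq => congrFun h ⟨q, hq⟩)

theorem claim2 {p : ℕ} (hp : p.Prime) (hG : Nat.card G = p) {σ : G}
    (hσ : ∀ g : G, g ∈ Subgroup.zpowers σ)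
    (hreg : ¬ p ∣ Nat.card (ClassGroup A)) [Finite (ClassGroup A)]
    (S : Finset (Ideal A)) (rep : Ideal A → Ideal B)
    (hrep : ∀ q ∈ S, (rep q).IsPrime ∧ (rep q) ≠ ⊥ ∧ (rep q).under A = q)
    (hS : ∀ P : Ideal B, P.IsPrime → P ≠ ⊥ → P.under A ∉ S → P.ramificationIdx A = 1)
    [Finite (ClassGroup B)] : Nat.card (invC0 B σ hp) ≤ (QQ hp S rep σ).index := by
  classical
  have : Fact p.Prime := ⟨hp⟩
  rw [← Subgroup.relIndex_bot_left, ← AddSubgroup.relIndex_top_right]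
  let f : ClassGroup B → (S → ZMod p) := fun c =>
    if h : c ∈ invC0 B σ hp then vv p S rep h.2.choose else 0
  have hf : ∀ c (h : c ∈ invC0 B σ hp), ∃ I : Ideal B, I ≠ ⊥ ∧ σ • I = I ∧ cls I = c ∧
      f c = vv p S rep I := fun c h =>
    ⟨h.2.choose, h.2.choose_spec.1, h.2.choose_spec.2.1, h.2.choose_spec.2.2, dif_pos h⟩
  refine index_le_of_rel _ _ _ _ ?_ f (fun c h => AddSubgroup.mem_top _) ?_
  · rw [AddSubgroup.relIndex_top_right]
    exact AddSubgroup.index_ne_zero_of_finite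
  intro c hc c' hc' hd
  have hcc := (invC0 B σ hp).div_mem hc hc'
  obtain ⟨I, hI, hi, rfl, e⟩ := hf c hc
  obtain ⟨I', hI', hi', rfl, e'⟩ := hf c' hc'
  obtain ⟨β, hβ, hβi, hv⟩ := hd
  rw [e, e'] at hv
  have hv' := (eq_add_of_sub_eq hv.symm).symm
  rw [← vv_mul p S rep (span_ne_bot hβ) hI'] at hv'
  obtain ⟨J, J', hJ, hJ', he⟩ := vv_compare hp hG hσ S rep hrep hS _ _
    (mul_ne_zero (span_ne_bot hβ) hI') hI (by rw [smul_ideal_mul, hβi, hi']) hi hv'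
  have hc1 := congrArg cls he
  rw [cls_mul (mul_ne_zero (span_ne_bot hβ) hI') (map_ne_bot hJ), cls_mul hI (map_ne_bot hJ'),
    cls_mul (span_ne_bot hβ) hI', cls_span hβ, one_mul] at hc1
  have hc2 : (cls I / cls I') ^ Nat.card (ClassGroup A) = 1 := by
    have := congrArg (fun x => x ^ Nat.card (ClassGroup A)) hc1
    simp only [mul_pow, ext_cls_pow hJ, ext_cls_pow hJ', mul_one] at this
    rw [div_pow, this, div_self']
  exact eq_one_of_coprime_pow ((Nat.Prime.coprime_iff_not_dvd hp).2 hreg) hcc.1 hc2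

theorem p_nsmul_mem_range {M : Type*} [AddCommGroup M] (s : AddMonoid.End M) (d n : M →+ M)
    (hd : ∀ x, d x = s x - x) (p : ℕ) (hn : ∀ x, n x = ∑ i ∈ Finset.range p, (s ^ i) x)
    (x : M) (hx : n x = 0) : p • x ∈ d.range := by
  have h1 : ∀ i : ℕ, (s ^ i) x - x ∈ d.range := by
    intro i
    induction i with
    | zero => simp
    | succ i ih =>
      have : (s ^ (i + 1)) x - x = d ((s ^ i) x) + ((s ^ i) x - x) := by
        rw [hd, pow_succ']
        change s ((s ^ i) x) - x = _
        abel
      rw [this]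
      exact d.range.add_mem ⟨_, rfl⟩ ih
  have h2 : -(p • x) = ∑ i ∈ Finset.range p, ((s ^ i) x - x) := by
    rw [Finset.sum_sub_distrib, ← hn, hx]
    simp
  rw [← neg_mem_iff, h2]
  exact AddSubgroup.sum_mem _ fun i _ => h1 i

theorem claim3 {p : ℕ} (hp : p.Prime) (hG : Nat.card G = p) {σ : G}
    (hσ : ∀ g : G, g ∈ Subgroup.zpowers σ)
    (hreg : ¬ p ∣ Nat.card (ClassGroup A)) [Finite (ClassGroup A)]
    (S : Finset (Ideal A)) (rep : Ideal A → Ideal B)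
    (hrep : ∀ q ∈ S, (rep q).IsPrime ∧ (rep q) ≠ ⊥ ∧ (rep q).under A = q)
    (hS : ∀ P : Ideal B, P.IsPrime → P ≠ ⊥ → P.under A ∉ S → P.ramificationIdx A = 1)
   
    (h90 : ∀ a b : B, a ≠ 0 → b ≠ 0 → nm σ p a = nm σ p b → ∃ x : B, x ≠ 0 ∧ a * σ • x = b * x) :
    (ud (B := B) σ).range.relIndex (un σ p).ker ≤ Nat.card (QQ hp S rep σ) := by
  classical
  have : Fact p.Prime := ⟨hp⟩
  rw [← AddSubgroup.relIndex_bot_left]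
  have hex : ∀ u ∈ (un (B := B) σ p).ker, ∃ x : B, x ≠ 0 ∧ (u.toMul : B) * σ • x = x := by
    intro u hu
    have h1 : nm σ p (u.toMul : B) = nm σ p 1 := by
      rw [← un_val, hu]
      simp [nm]
    obtain ⟨x, hx, e⟩ := h90 _ _ u.toMul.ne_zero one_ne_zero h1
    exact ⟨x, hx, by rw [e, one_mul]⟩
  let f : Additive Bˣ → (S → ZMod p) := fun u =>
    if h : u ∈ (un (B := B) σ p).ker then vv p S rep (Ideal.span {(hex u h).choose}) else 0
  have hinv : ∀ (u : Additive Bˣ) (x : B), (u.toMul : B) * σ • x = x →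
      σ • Ideal.span {x} = Ideal.span {x} := by
    intro u x h
    rw [smul_ideal_span, Ideal.span_singleton_eq_span_singleton]
    exact ⟨u.toMul, by rw [mul_comm, h]⟩
  have hf : ∀ u (h : u ∈ (un (B := B) σ p).ker), ∃ x : B, x ≠ 0 ∧ (u.toMul : B) * σ • x = x ∧
      f u = vv p S rep (Ideal.span {x}) := fun u h =>
    ⟨(hex u h).choose, (hex u h).choose_spec.1, (hex u h).choose_spec.2, dif_pos h⟩
  refine index_le_of_rel_add _ _ _ _ ?_ f ?_ ?_
  · rw [AddSubgroup.relIndex_bot_left]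
    exact Nat.card_pos.ne'
  · intro u hu
    obtain ⟨x, hx, e, h⟩ := hf u hu
    exact ⟨x, hx, hinv u x e, h.symm⟩
  intro u hu u' hu' hd
  obtain ⟨x, hx, e, h⟩ := hf u hu
  obtain ⟨x', hx', e', h'⟩ := hf u' hu'
  rw [AddSubgroup.mem_bot, sub_eq_zero, h, h'] at hd
  obtain ⟨J, J', hJ, hJ', he⟩ := vv_compare hp hG hσ S rep hrep hS _ _
    (span_ne_bot hx) (span_ne_bot hx') (hinv u x e) (hinv u' x' e') hd
  obtain ⟨j, hj, ej⟩ := ext_pow_principal B hJ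
  obtain ⟨j', hj', ej'⟩ := ext_pow_principal B hJ'
  set k := Nat.card (ClassGroup A)
  have he2 := congrArg (fun t => t ^ k) he
  simp only [mul_pow, ej, ej', Ideal.span_singleton_pow, Ideal.span_singleton_mul_span_singleton,
    Ideal.span_singleton_eq_span_singleton] at he2
  obtain ⟨w, hw⟩ := he2
  have hcomm := IsGaloisGroup.commutes (G := G) (A := A) (B := B)
  have hj0 : algebraMap A B j ≠ 0 := by rwa [Ne, FaithfulSMul.algebraMap_eq_zero_iff]
  have hj0' : algebraMap A B j' ≠ 0 := by rwa [Ne, FaithfulSMul.algebraMap_eq_zero_iff]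
  have hx1 : σ • x ≠ 0 := by rwa [Ne, smul_eq_zero_iff_eq]
  have hx1' : σ • x' ≠ 0 := by rwa [Ne, smul_eq_zero_iff_eq]
  have hk : k • (u - u') ∈ (ud (B := B) σ).range := by
    refine ⟨Additive.ofMul w, ?_⟩
    rw [ud_apply, nsmul_sub, sub_eq_sub_iff_add_eq_add]
    apply Additive.toMul.injective
    apply Units.ext
    rw [toMul_add, toMul_add, Units.val_mul, Units.val_mul, us_val, toMul_ofMul, toMul_nsmul,
      toMul_nsmul, Units.val_pow_eq_pow_val, Units.val_pow_eq_pow_val]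
    have hw2 := congrArg (fun t => σ • t) hw
    simp only [smul_mul', smul_pow', smul_algebraMap] at hw2
    have hz : (σ • x) ^ k * algebraMap A B j * (σ • x') ^ k * algebraMap A B j' ≠ 0 :=
      mul_ne_zero (mul_ne_zero (mul_ne_zero (pow_ne_zero _ hx1) hj0) (pow_ne_zero _ hx1')) hj0'
    apply mul_left_cancel₀ hz
    calc (σ • x) ^ k * algebraMap A B j * (σ • x') ^ k * algebraMap A B j' * (σ • (w : B) * (u'.toMul : B) ^ k)
        = ((σ • x) ^ k * algebraMap A B j * σ • (w : B)) * ((u'.toMul : B) * σ • x') ^ k * algebraMap A B j' := by ring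
      _ = (σ • x') ^ k * algebraMap A B j' * (x' ^ k * algebraMap A B j') := by rw [hw2, e']; ring
      _ = (σ • x') ^ k * algebraMap A B j' * (((u.toMul : B) * σ • x) ^ k * algebraMap A B j * w) := by rw [← hw, e]
      _ = _ := by ring
  refine mem_of_coprime_nsmul _ ((Nat.Prime.coprime_iff_not_dvd hp).2 hreg) ?_ hk
  apply p_nsmul_mem_range (us σ) _ (un σ p) (ud_apply σ) p (un_apply σ p)
  exact (un σ p).ker.sub_mem hu hu'

theorem counting {p : ℕ} (hp : p.Prime) (hG : Nat.card G = p) {σ : G}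
    (hσ : ∀ g : G, g ∈ Subgroup.zpowers σ)
    (hreg : ¬ p ∣ Nat.card (ClassGroup A)) [Finite (ClassGroup A)]
    (S : Finset (Ideal A)) (rep : Ideal A → Ideal B)
    (hrep : ∀ q ∈ S, (rep q).IsPrime ∧ (rep q) ≠ ⊥ ∧ (rep q).under A = q)
    (hS : ∀ P : Ideal B, P.IsPrime → P ≠ ⊥ → P.under A ∉ S → P.ramificationIdx A = 1)
    [Finite (ClassGroup B)]
    (h90 : ∀ a b : B, a ≠ 0 → b ≠ 0 → nm σ p a = nm σ p b → ∃ x : B, x ≠ 0 ∧ a * σ • x = b * x)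
    (hH : p * (un (B := B) σ p).range.relIndex (ud σ).ker ≤ (ud (B := B) σ).range.relIndex (un σ p).ker)
    (hH0 : (un (B := B) σ p).range.relIndex (ud σ).ker ≠ 0) :
    Nat.card (invC B σ p) * (unT (B := B) σ p).relIndex (ud σ).ker * p ≤ p ^ S.card := by
  have : Fact p.Prime := ⟨hp⟩
  have hσp : σ ^ p = 1 := by rw [← hG]; exact pow_card_eq_one'
  have hmul := AddSubgroup.relIndex_mul_relIndex _ _ _ (un_range_le (B := B) hσp) (unT_le σ p)
  have hne : (un (B := B) σ p).range.relIndex (unT σ p) ≠ 0 := by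
    intro h; rw [h, zero_mul] at hmul; exact hH0 hmul.symm
  have c1 := claim1 hp hσp h90 (exists_int_inverse A σ) hne
  have c2 := claim2 hp hG hσ hreg S rep hrep hS
  have c3 := claim3 hp hG hσ hreg S rep hrep hS h90
  have hB := Subgroup.relIndex_mul_relIndex ⊥ _ _ bot_le (invC0_le (B := B) σ hp)
  rw [Subgroup.relIndex_bot_left, Subgroup.relIndex_bot_left] at hB
  have hQ := AddSubgroup.card_mul_index (QQ hp S rep σ)
  have hcard : Nat.card (S → ZMod p) = p ^ S.card := by
    rw [Nat.card_fun, Nat.card_zmod]; simp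
  rw [hcard] at hQ
  rw [← hB, ← hQ]
  set b0 := Nat.card (invC0 B σ hp)
  set ι := (unT (B := B) σ p).relIndex (ud σ).ker
  set τ := (un (B := B) σ p).range.relIndex (unT σ p)
  calc b0 * (invC0 B σ hp).relIndex (invC B σ p) * ι * p ≤ b0 * τ * ι * p := by gcongr
    _ = b0 * (p * (τ * ι)) := by ring
    _ ≤ (QQ hp S rep σ).index * Nat.card (QQ hp S rep σ) := by
        rw [hmul]; exact Nat.mul_le_mul c2 (hH.trans c3)
    _ = _ := by ring

end PartC3

end BlockC3

section BlockG

open UniqueFactorizationMonoid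
open scoped Pointwise nonZeroDivisors NumberField

section PartG
open NumberField

theorem cyc_of_gen {p : ℕ} (hp : p.Prime) {K : Type} [Field K] [NumberField K]
    {ζK : K} (hζK : IsPrimitiveRoot ζK p)
    (hKgen : Algebra.adjoin ℚ {ζK} = (⊤ : Subalgebra ℚ K)) : IsCyclotomicExtension {p} ℚ K := by
  have : NeZero p := ⟨hp.ne_zero⟩
  rw [IsCyclotomicExtension.iff_singleton]
  refine ⟨⟨ζK, hζK⟩, fun x => ?_⟩
  have hx : x ∈ Algebra.adjoin ℚ {ζK} := by rw [hKgen]; trivial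
  refine Algebra.adjoin_mono ?_ hx
  rintro _ rfl
  exact hζK.pow_eq_one

theorem exists_emb {p : ℕ} (hp : p.Prime) {K L : Type} [Field K] [NumberField K]
    [Field L] [NumberField L]
    {ζK : K} (hζK : IsPrimitiveRoot ζK p) [IsCyclotomicExtension {p} ℚ K]
    {ζ : L} (hζ : IsPrimitiveRoot ζ p) : ∃ f : K →+* L, f ζK = ζ := by
  have : NeZero p := ⟨hp.ne_zero⟩
  have h : (Polynomial.aeval ζ) (minpoly ℚ (hζK.powerBasis ℚ).gen) = 0 := by
    rw [IsPrimitiveRoot.powerBasis_gen, ← hζK.minpoly_eq_cyclotomic_of_irreducible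
      (Polynomial.cyclotomic.irreducible_rat hp.pos)]
    rw [Polynomial.aeval_def, Polynomial.eval₂_eq_eval_map, Polynomial.map_cyclotomic]
    exact hζ.isRoot_cyclotomic hp.pos
  refine ⟨((hζK.powerBasis ℚ).lift ζ h : K →+* L), ?_⟩
  have := (hζK.powerBasis ℚ).lift_gen ζ h
  simpa using this

theorem not_pth_power {p N : ℕ} (hp : p.Prime) (hN : N.Prime) {K : Type} [Field K] [NumberField K]
    [IsCyclotomicExtension {p} ℚ K] (b : K) : b ^ p ≠ (N : K) := by
  intro h
  have : NeZero p := ⟨hp.ne_zero⟩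
  have : Fact N.Prime := ⟨hN⟩
  have hr : Module.finrank ℚ K = p - 1 := by
    rw [IsCyclotomicExtension.finrank (n := p) K (Polynomial.cyclotomic.irreducible_rat hp.pos),
      Nat.totient_prime hp]
  have h1 := congrArg (Algebra.norm ℚ) h
  have h2 : (N : K) = algebraMap ℚ K (N : ℚ) := by simp
  rw [map_pow, h2, Algebra.norm_algebraMap, hr] at h1
  have h3 := congrArg (padicValRat N) h1
  have hN0 : (N : ℚ) ≠ 0 := by exact_mod_cast hN.ne_zero
  have hb0 : Algebra.norm ℚ b ≠ 0 := by
    intro h0; rw [h0, zero_pow hp.ne_zero] at h1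
    exact pow_ne_zero _ hN0 h1.symm
  rw [padicValRat.pow, padicValRat.pow, padicValRat.self hN.one_lt] at h3
  have h4 : (p : ℤ) ∣ ((p - 1 : ℕ) : ℤ) := ⟨_, by rw [h3]; ring⟩
  rw [Int.natCast_dvd_natCast] at h4
  have := Nat.le_of_dvd (by have := hp.two_le; omega) h4
  have := hp.two_le; omega

theorem adjoin_top {K L : Type} [Field K] [NumberField K]
    [Field L] [NumberField L] [Algebra K L] {ζK : K} {ζ α : L} (hf : algebraMap K L ζK = ζ)
    (hLgen : Algebra.adjoin ℚ {ζ, α} = (⊤ : Subalgebra ℚ L)) :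
    IntermediateField.adjoin K {α} = ⊤ := by
  rw [eq_top_iff]
  intro x _
  have hx : x ∈ Algebra.adjoin ℚ {ζ, α} := by rw [hLgen]; trivial
  have : Algebra.adjoin ℚ {ζ, α} ≤
      ((IntermediateField.adjoin K {α}).toSubalgebra.restrictScalars ℚ) := by
    rw [Algebra.adjoin_le_iff]
    rintro y (rfl | rfl)
    · rw [← hf]
      exact (IntermediateField.adjoin K {α}).algebraMap_mem ζK
    · exact IntermediateField.mem_adjoin_simple_self K y
  exact this hx

theorem kummer_setup {p N : ℕ} (hp : p.Prime) (hN : N.Prime) {K L : Type} [Field K] [NumberField K]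
    [Field L] [NumberField L] [Algebra K L] [IsCyclotomicExtension {p} ℚ K]
    {ζK : K} (hζK : IsPrimitiveRoot ζK p) {α : L} (hα : α ^ p = (N : L))
    (htop : IntermediateField.adjoin K {α} = ⊤) :
    Module.finrank K L = p ∧ IsGalois K L ∧ IsCyclic Gal(L/K) ∧ Nat.card Gal(L/K) = p ∧
      minpoly K α = Polynomial.X ^ p - Polynomial.C (N : K) := by
  have hirr : Irreducible (Polynomial.X ^ p - Polynomial.C (N : K)) :=
    X_pow_sub_C_irreducible_of_prime hp (fun b => not_pth_power hp hN b)
  have hmin : Polynomial.X ^ p - Polynomial.C (N : K) = minpoly K α := by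
    apply minpoly.eq_of_irreducible_of_monic hirr
    · simp [hα]
    · exact Polynomial.monic_X_pow_sub_C _ hp.ne_zero
  have hfr : Module.finrank K L = p := by
    rw [← IntermediateField.finrank_top', ← htop,
      IntermediateField.adjoin.finrank (Algebra.IsIntegral.isIntegral α), ← hmin,
      Polynomial.natDegree_X_pow_sub_C]
  have hne : (primitiveRoots (Module.finrank K L) K).Nonempty := by
    rw [hfr]; exact ⟨ζK, (mem_primitiveRoots hp.pos).2 hζK⟩
  have : NeZero (Module.finrank K L) := ⟨by rw [hfr]; exact hp.ne_zero⟩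
  have hspl : Polynomial.IsSplittingField K L (Polynomial.X ^ (Module.finrank K L) - Polynomial.C (N : K)) := by
    apply isSplittingField_X_pow_sub_C_of_root_adjoin_eq_top hne _ htop
    rw [hfr, hα]; simp
  have hirr' : Irreducible (Polynomial.X ^ (Module.finrank K L) - Polynomial.C (N : K)) := by
    rw [hfr]; exact hirr
  have hgal := isGalois_of_isSplittingField_X_pow_sub_C hne hirr' L
  exact ⟨hfr, hgal, isCyclic_of_isSplittingField_X_pow_sub_C hne hirr' L, 
    by rw [IsGalois.card_aut_eq_finrank, hfr], hmin.symm⟩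

theorem h90_int {p : ℕ} {K L : Type} [Field K] [NumberField K]
    [Field L] [NumberField L] [Algebra K L] [IsGalois K L] [IsCyclic Gal(L/K)] (hp : p.Prime)
    (hG : Nat.card Gal(L/K) = p) {σ : Gal(L/K)} (hσ : ∀ g, g ∈ Subgroup.zpowers σ)
    (a b : 𝓞 L) (ha : a ≠ 0) (hb : b ≠ 0) (hab : nm σ p a = nm σ p b) :
    ∃ x : 𝓞 L, x ≠ 0 ∧ a * σ • x = b * x := by
  have key : ∀ c : 𝓞 L, algebraMap K L (Algebra.norm K (c : L)) = (nm σ p c : 𝓞 L) := by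
    intro c
    rw [Algebra.norm_eq_prod_automorphisms, prod_univ_eq_prod_range hσ hG]
    exact (map_prod (algebraMap (𝓞 L) L) (fun i => σ ^ i • c) (Finset.range p)).symm
  have ha' : (a : L) ≠ 0 := by simpa using ha
  have hb' : (b : L) ≠ 0 := by simpa using hb
  have hn : Algebra.norm K ((a : L) / b) = 1 := by
    have hb1 : algebraMap K L (Algebra.norm K (b : L)) ≠ 0 := by
      rw [Ne, map_eq_zero, Algebra.norm_eq_zero_iff]
      exact hb'
    have h1 : Algebra.norm K ((a : L) / b) * Algebra.norm K (b : L) = Algebra.norm K (a : L) := by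
      rw [← map_mul, div_mul_cancel₀ _ hb']
    apply (algebraMap K L).injective
    rw [map_one]
    apply mul_right_cancel₀ hb1
    rw [← map_mul, h1, key, key, hab, one_mul]
  obtain ⟨y, hy⟩ := groupCohomology.exists_div_of_norm_eq_one hσ hn
  have halg : IsAlgebraic ℤ (y : L) :=
    ((IsFractionRing.isAlgebraic_iff ℤ ℚ L).2 (Algebra.IsAlgebraic.isAlgebraic (y : L)))
  obtain ⟨m, hm0, hm⟩ := halg.exists_integral_multiple
  have hm0' : (m : L) ≠ 0 := by exact_mod_cast hm0
  obtain ⟨x, hx⟩ : ∃ x : 𝓞 L, algebraMap (𝓞 L) L x = m • (y : L) := ⟨⟨_, hm⟩, rfl⟩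
  rw [zsmul_eq_mul] at hx
  refine ⟨x, ?_, ?_⟩
  · rintro rfl
    exact mul_ne_zero hm0' y.ne_zero (by rw [← hx, map_zero])
  · apply RingOfIntegers.ext
    change algebraMap (𝓞 L) L a * σ (algebraMap (𝓞 L) L x) =
      algebraMap (𝓞 L) L b * algebraMap (𝓞 L) L x
    rw [hx, map_mul, map_intCast]
    have hσy : σ (y : L) ≠ 0 := by
      rw [Ne, map_eq_zero_iff _ σ.injective]; exact y.ne_zero
    rw [div_eq_div_iff hσy hb'] at hy
    change (y : L) * algebraMap (𝓞 L) L b = algebraMap (𝓞 L) L a * σ (y : L) at hy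
    linear_combination (m : L) * (-hy)
end PartG

end BlockG

section BlockF

open UniqueFactorizationMonoid
open scoped Pointwise nonZeroDivisors NumberField

section PartF
open NumberField

theorem unit_rank {p : ℕ} (hp2 : 2 < p) {M : Type} [Field M] [NumberField M]
    {z : M} (hz : IsPrimitiveRoot z p) :
    2 * Module.finrank ℤ (Additive (𝓞 M)ˣ) + 2 = Module.finrank ℚ M := by
  classical
  rw [Units.finrank_eq, Units.rank]
  have h1 := NumberField.InfinitePlace.IsPrimitiveRoot.nrRealPlaces_eq_zero_of_two_lt hp2 hz
  have h2 := InfinitePlace.card_add_two_mul_card_eq_rank M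
  have h3 := InfinitePlace.card_eq_nrRealPlaces_add_nrComplexPlaces M
  have h4 : 0 < Fintype.card (InfinitePlace M) := Fintype.card_pos
  omega

theorem exists_zeta_unit {p : ℕ} (hp : p.Prime) {M : Type} [Field M] [NumberField M]
    {z : M} (hz : IsPrimitiveRoot z p) :
    ∃ u : (𝓞 M)ˣ, algebraMap (𝓞 M) M u = z ∧ IsPrimitiveRoot u p := by
  have : NeZero p := ⟨hp.ne_zero⟩
  have h := hz.toInteger_isPrimitiveRoot
  obtain ⟨u, hu⟩ := h.isUnit hp.ne_zero
  refine ⟨u, by rw [hu]; rfl, ?_⟩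
  rw [← hu] at h
  exact IsPrimitiveRoot.coe_units_iff.1 h

theorem ker_rank {K L : Type} [Field K] [NumberField K]
    [Field L] [NumberField L] [Algebra K L] [IsGalois K L]
    {σ : Gal(L/K)} (hσ : ∀ g, g ∈ Subgroup.zpowers σ) :
    Module.finrank ℤ (ud (B := 𝓞 L) σ).ker = Module.finrank ℤ (Additive (𝓞 K)ˣ) := by
  let φ : Additive (𝓞 K)ˣ →+ Additive (𝓞 L)ˣ :=
    MonoidHom.toAdditive (Units.map (algebraMap (𝓞 K) (𝓞 L) : 𝓞 K →* 𝓞 L))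
  have hφ : ∀ u, ((φ u).toMul : 𝓞 L) = algebraMap (𝓞 K) (𝓞 L) (u.toMul : 𝓞 K) := fun u => rfl
  have hinj0 : Function.Injective (algebraMap (𝓞 K) (𝓞 L)) := FaithfulSMul.algebraMap_injective _ _
  have hinj : Function.Injective φ := by
    intro u v h
    apply Additive.toMul.injective
    apply Units.ext
    apply hinj0
    rw [← hφ, ← hφ, h]
  have hr : φ.range = (ud (B := 𝓞 L) σ).ker := by
    ext x
    rw [mem_ud_ker]
    constructor
    · rintro ⟨u, rfl⟩
      rw [hφ, smul_algebraMap]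
    · intro hx
      have hfix : ∀ y : 𝓞 L, σ • y = y → ∃ a, algebraMap (𝓞 K) (𝓞 L) a = y := by
        intro y hy
        apply Algebra.IsInvariant.isInvariant (A := 𝓞 K) (G := Gal(L/K)) y
        intro g
        have : g ∈ MulAction.stabilizer Gal(L/K) y :=
          (Subgroup.zpowers_le.2 (show σ ∈ MulAction.stabilizer Gal(L/K) y from hy)) (hσ g)
        exact this
      obtain ⟨a, ha⟩ := hfix _ hx
      have hx' : σ • ((x.toMul⁻¹ : (𝓞 L)ˣ) : 𝓞 L) = ((x.toMul⁻¹ : (𝓞 L)ˣ) : 𝓞 L) := by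
        apply mul_left_cancel₀ x.toMul.ne_zero
        nth_rewrite 1 [← hx]
        rw [← smul_mul']
        simp
      obtain ⟨b, hb⟩ := hfix _ hx'
      refine ⟨Additive.ofMul ⟨a, b, ?_, ?_⟩, ?_⟩
      · apply hinj0; rw [map_mul, ha, hb, map_one]; simp
      · apply hinj0; rw [map_mul, ha, hb, map_one]; simp
      · apply Additive.toMul.injective
        apply Units.ext
        rw [hφ]; exact ha
  rw [← hr]
  exact (AddMonoidHom.ofInjective hinj).toIntLinearEquiv.finrank_eq.symm

theorem tors_card {p : ℕ} (hp : p.Prime) {L : Type} [Field L] [NumberField L] :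
    Finite (nsmulAddMonoidHom p : Additive (𝓞 L)ˣ →+ Additive (𝓞 L)ˣ).ker ∧
    Nat.card (nsmulAddMonoidHom p : Additive (𝓞 L)ˣ →+ Additive (𝓞 L)ˣ).ker ≤ p := by
  have : NeZero p := ⟨hp.ne_zero⟩
  have h : ∀ x : Additive (𝓞 L)ˣ, x ∈ (nsmulAddMonoidHom p : Additive (𝓞 L)ˣ →+ Additive (𝓞 L)ˣ).ker →
      x.toMul ∈ rootsOfUnity p (𝓞 L) := by
    intro x hx
    rw [AddMonoidHom.mem_ker] at hx
    exact hx
  let f : (nsmulAddMonoidHom p : Additive (𝓞 L)ˣ →+ Additive (𝓞 L)ˣ).ker → rootsOfUnity p (𝓞 L) :=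
    fun x => ⟨x.1.toMul, h _ x.2⟩
  have hinj : Function.Injective f := by
    intro x y h
    apply Subtype.ext
    exact congrArg Subtype.val h
  exact ⟨Finite.of_injective _ hinj,
    (Nat.card_le_card_of_injective _ hinj).trans (card_rootsOfUnity _ _)⟩

theorem herbrand_apply {p : ℕ} (hp : p.Prime) (hodd : Odd p) {K L : Type} [Field K] [NumberField K]
    [Field L] [NumberField L] [Algebra K L] [IsGalois K L] [IsCyclotomicExtension {p} ℚ K]
    (hG : Nat.card Gal(L/K) = p) {σ : Gal(L/K)} (hσ : ∀ g, g ∈ Subgroup.zpowers σ)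
    {ζK : K} (hζK : IsPrimitiveRoot ζK p) :
    p * (un (B := 𝓞 L) σ p).range.relIndex (ud σ).ker ≤ (ud (B := 𝓞 L) σ).range.relIndex (un σ p).ker ∧
    (un (B := 𝓞 L) σ p).range.relIndex (ud σ).ker ≠ 0 := by
  have hp2 : 2 < p := by
    rcases hodd with ⟨k, hk⟩; have := hp.two_le; omega
  have : NeZero p := ⟨hp.ne_zero⟩
  have hσp : σ ^ p = 1 := by rw [← hG]; exact pow_card_eq_one'
  have hrK : Module.finrank ℚ K = p - 1 := by
    rw [IsCyclotomicExtension.finrank (n := p) K (Polynomial.cyclotomic.irreducible_rat hp.pos),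
      Nat.totient_prime hp]
  have hrL : Module.finrank ℚ L = p * (p - 1) := by
    rw [← Module.finrank_mul_finrank ℚ K L, hrK, ← IsGalois.card_aut_eq_finrank, hG, mul_comm]
  obtain ⟨u, hu, hup⟩ := exists_zeta_unit hp (hζK.map_of_injective (algebraMap K L).injective)
  obtain ⟨hfin, htor⟩ := tors_card (L := L) hp
  have hus : (us σ : AddMonoid.End (Additive (𝓞 L)ˣ)) ^ p = 1 := by
    ext x
    rw [us_pow, hσp, one_smul]; rfl
  have hr1 : 2 * Module.finrank ℤ (Additive (𝓞 L)ˣ) + 2 = p * (p - 1) := by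
    rw [unit_rank hp2 (hζK.map_of_injective (algebraMap K L).injective), hrL]
  have hr2 : 2 * Module.finrank ℤ (ud (B := 𝓞 L) σ).ker + 3 = p := by
    have := unit_rank hp2 hζK
    rw [ker_rank hσ]
    omega
  have hz0 : Additive.ofMul u ≠ 0 := by
    intro h
    have h2 : u = 1 := h
    rw [h2, IsPrimitiveRoot.one_left_iff] at hup
    omega
  have hpz : p • Additive.ofMul u = 0 := hup.pow_eq_one
  have hsz : us σ (Additive.ofMul u) = Additive.ofMul u := by
    apply Additive.toMul.injective
    apply Units.ext
    rw [us_val]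
    apply RingOfIntegers.ext
    change σ (algebraMap (𝓞 L) L u) = algebraMap (𝓞 L) L u
    rw [hu, AlgEquiv.commutes]
  have H1 := herbrand_units (M := Additive (𝓞 L)ˣ) p hp hodd (us σ) hus
  have H2 := H1 (ud σ) (un σ p) (ud_apply σ) (un_apply σ p)
  have H3 := H2 hr1
  have H4 := H3 hr2
  have H5 := H4 htor hfin
  have H6 := H5 (Additive.ofMul u) hz0 hpz hsz
  exact H6
end PartF

end BlockF

section BlockD

open UniqueFactorizationMonoid
open scoped Pointwise nonZeroDivisors NumberField

section PartD
open NumberField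

theorem unram_crit {K L : Type} [Field K] [NumberField K]
    [Field L] [NumberField L] [Algebra K L] (x : 𝓞 L)
    (hx : Algebra.adjoin K {algebraMap (𝓞 L) L x} = ⊤) (g : Polynomial (𝓞 K))
    (hg : Polynomial.aeval x g = 0) (P : Ideal (𝓞 L)) (hP : P.IsPrime)
    (hgP : Polynomial.aeval x (Polynomial.derivative g) ∉ P) : P.ramificationIdx (𝓞 K) = 1 := by
  have hxi : IsIntegral (𝓞 K) x := Algebra.IsIntegral.isIntegral x
  obtain ⟨q, hq⟩ := minpoly.isIntegrallyClosed_dvd hxi hg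
  have hm : Polynomial.aeval x (Polynomial.derivative (minpoly (𝓞 K) x)) ∉ P := by
    intro h
    apply hgP
    rw [hq, Polynomial.derivative_mul, map_add, map_mul, map_mul, minpoly.aeval, zero_mul, add_zero]
    exact P.mul_mem_right _ h
  have hD := aeval_derivative_mem_differentIdeal (𝓞 K) K L x hx
  have hnd : ¬ P ∣ differentIdeal (𝓞 K) (𝓞 L) := by
    intro h
    exact hm (Ideal.le_of_dvd h hD)
  have := not_dvd_differentIdeal_iff.1 hnd
  exact Ideal.ramificationIdx_eq_one P (𝓞 K)

theorem gamma_poly {R : Type*} [CommRing R] [IsDomain R] {p : ℕ} (hp : p.Prime) (π : R) (hπ : π ≠ 0)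
    (h1 : π ^ (p - 1) ∣ (p : R)) (n : R) (hn : π ^ p ∣ 1 - n) :
    ∃ g : Polynomial R, g.Monic ∧
      (1 + Polynomial.C π * Polynomial.X) ^ p - Polynomial.C n = Polynomial.C (π ^ p) * g := by
  have hcoef : ∀ k, ((1 + Polynomial.C π * Polynomial.X) ^ p : Polynomial R).coeff k
      = p.choose k * π ^ k := by
    intro k
    have : ((1 + Polynomial.C π * Polynomial.X) ^ p : Polynomial R) =
        ((1 + Polynomial.X) ^ p : Polynomial R).comp (Polynomial.C π * Polynomial.X) := by simp
    rw [this, Polynomial.comp_C_mul_X_coeff, Polynomial.coeff_one_add_X_pow]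
  have hd : Polynomial.C (π ^ p) ∣ (1 + Polynomial.C π * Polynomial.X) ^ p - Polynomial.C n := by
    rw [Polynomial.C_dvd_iff_dvd_coeff]
    intro k
    rw [Polynomial.coeff_sub, hcoef, Polynomial.coeff_C]
    split_ifs with hk
    · subst hk; simpa using hn
    · rw [sub_zero]
      rcases lt_trichotomy k p with h | h | h
      · have h2 : p ∣ p.choose k := hp.dvd_choose_self hk h
        have h3 : (p : R) ∣ (p.choose k : R) := by exact_mod_cast (Nat.cast_dvd_cast (α := R) h2)
        have h4 : π ∣ π ^ k := dvd_pow_self _ hk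
        have h5 := mul_dvd_mul (h1.trans h3) h4
        rwa [← pow_succ, Nat.sub_add_cancel hp.one_le] at h5
      · subst h; exact Dvd.intro_left _ rfl
      · rw [Nat.choose_eq_zero_of_lt h]; simp
  obtain ⟨g, hg⟩ := hd
  refine ⟨g, ?_, hg⟩
  have hc : ∀ k, k ≠ 0 → π ^ p * g.coeff k = p.choose k * π ^ k := by
    intro k hk
    rw [← Polynomial.coeff_C_mul, ← hg, Polynomial.coeff_sub, hcoef, Polynomial.coeff_C, if_neg hk,
      sub_zero]
  apply Polynomial.monic_of_natDegree_le_of_coeff_eq_one p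
  · rw [Polynomial.natDegree_le_iff_coeff_eq_zero]
    intro k hk
    have := hc k (by omega)
    rw [Nat.choose_eq_zero_of_lt hk] at this
    simpa [hπ] using this
  · have := hc p hp.ne_zero
    rw [Nat.choose_self, Nat.cast_one, mul_comm] at this
    exact mul_right_cancel₀ (pow_ne_zero _ hπ) this

theorem unram_tame {p N : ℕ} {K L : Type} [Field K] [NumberField K]
    [Field L] [NumberField L] [Algebra K L] (a : 𝓞 L) (ha : a ^ p = (N : 𝓞 L))
    (hadj : Algebra.adjoin K {algebraMap (𝓞 L) L a} = ⊤) (P : Ideal (𝓞 L)) (hP : P.IsPrime)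
    (haP : a ∉ P) (hpP : (p : 𝓞 L) ∉ P) : P.ramificationIdx (𝓞 K) = 1 := by
  refine unram_crit a hadj (Polynomial.X ^ p - Polynomial.C (N : 𝓞 K)) ?_ P hP ?_
  · simp [ha]
  · rw [Polynomial.derivative_sub, Polynomial.derivative_C, sub_zero, Polynomial.derivative_X_pow,
      map_mul, Polynomial.aeval_C, map_natCast, map_pow, Polynomial.aeval_X]
    intro h
    rcases hP.mem_or_mem h with h | h
    · exact hpP h
    · exact haP (hP.mem_of_pow_mem _ h)

theorem unram_wild {p N : ℕ} (hp : p.Prime) {K L : Type} [Field K] [NumberField K]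
    [Field L] [NumberField L] [Algebra K L] {ζK : K} (hζK : IsPrimitiveRoot ζK p)
    (a : 𝓞 L) (ha : a ^ p = (N : 𝓞 L))
    (hadj : Algebra.adjoin K {algebraMap (𝓞 L) L a} = ⊤) (hN : ((p : ℤ) ^ 2) ∣ 1 - (N : ℤ))
    (P : Ideal (𝓞 L)) (hP : P.IsPrime)
    (haP : a ∉ P) : P.ramificationIdx (𝓞 K) = 1 := by
  have : Fact p.Prime := ⟨hp⟩
  have : NeZero p := ⟨hp.ne_zero⟩
  obtain ⟨u, hu⟩ := IsCyclotomicExtension.Rat.associated_zeta_sub_one_pow_prime p hζK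
  set π : 𝓞 K := hζK.toInteger - 1 with hπdef
  have hp0 : (p : 𝓞 K) ≠ 0 := by exact_mod_cast hp.ne_zero
  have hπ : π ≠ 0 := by
    intro h
    rw [h, zero_pow (by have := hp.two_le; omega), zero_mul] at hu
    exact hp0 hu.symm
  have hd1 : π ^ (p - 1) ∣ (p : 𝓞 K) := ⟨u, hu.symm⟩
  have hd2 : π ^ p ∣ 1 - (N : 𝓞 K) := by
    have h2 : (p : 𝓞 K) ^ 2 ∣ 1 - (N : 𝓞 K) := by
      have := Int.cast_dvd_cast (α := 𝓞 K) _ _ hN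
      exact_mod_cast this
    refine dvd_trans ?_ h2
    refine dvd_trans (pow_dvd_pow π (?_ : p ≤ (p - 1) * 2)) ?_
    · have := hp.two_le; omega
    · rw [pow_mul]; exact pow_dvd_pow_of_dvd hd1 2
  obtain ⟨g, hgm, hg⟩ := gamma_poly hp π hπ hd1 (N : 𝓞 K) hd2
  set πL : L := algebraMap (𝓞 K) L π with hπL
  have hinj : Function.Injective (algebraMap (𝓞 K) L) := FaithfulSMul.algebraMap_injective _ _
  have hπL0 : πL ≠ 0 := by
    rw [hπL, Ne, map_eq_zero_iff _ hinj]; exact hπ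
  set α : L := algebraMap (𝓞 L) L a with hα
  have hαp : α ^ p = (N : L) := by rw [hα, ← map_pow, ha, map_natCast]
  set γ : L := (α - 1) / πL with hγ
  have hγ1 : 1 + πL * γ = α := by rw [hγ]; field_simp; ring
  have hgγ : Polynomial.aeval γ g = 0 := by
    have h := congrArg (Polynomial.aeval γ) hg
    simp only [map_sub, map_pow, map_add, map_one, map_mul, Polynomial.aeval_C, Polynomial.aeval_X,
      map_natCast] at h
    rw [← hπL, hγ1, hαp, sub_self] at h
    exact (mul_eq_zero.1 h.symm).resolve_left (pow_ne_zero _ hπL0)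
  have hintg : IsIntegral (𝓞 K) γ := ⟨g, hgm, hgγ⟩
  have hintZ : IsIntegral ℤ γ := isIntegral_trans γ hintg
  obtain ⟨c, hc⟩ : ∃ c : 𝓞 L, algebraMap (𝓞 L) L c = γ := ⟨⟨γ, hintZ⟩, rfl⟩
  have hinjL : Function.Injective (algebraMap (𝓞 L) L) := FaithfulSMul.algebraMap_injective _ _
  refine unram_crit c ?_ g ?_ P hP ?_
  · rw [hc, eq_top_iff, ← hadj]
    apply Algebra.adjoin_le
    rintro _ rfl
    rw [← hγ1]
    refine add_mem (one_mem _) (mul_mem ?_ (Algebra.subset_adjoin rfl))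
    rw [hπL, IsScalarTower.algebraMap_apply (𝓞 K) K L]
    exact Subalgebra.algebraMap_mem _ _
  · apply hinjL
    rw [map_zero, ← Polynomial.aeval_algebraMap_apply, hc, hgγ]
  · have hder : Polynomial.aeval c (Polynomial.derivative g) = algebraMap (𝓞 K) (𝓞 L) u * a ^ (p - 1) := by
      apply hinjL
      rw [← Polynomial.aeval_algebraMap_apply, hc]
      have h := congrArg (fun q => Polynomial.aeval γ (Polynomial.derivative q)) hg
      simp only [Polynomial.derivative_sub, Polynomial.derivative_C, sub_zero,
        Polynomial.derivative_pow, Polynomial.derivative_add, Polynomial.derivative_one, zero_add,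
        Polynomial.derivative_C_mul, Polynomial.derivative_X, mul_one] at h
      simp only [map_pow, map_add, map_one, map_mul, Polynomial.aeval_C, Polynomial.aeval_X,
        map_natCast] at h
      rw [← hπL, hγ1] at h
      have hu' := congrArg (algebraMap (𝓞 K) L) hu
      rw [map_mul, map_pow, map_natCast, ← hπL] at hu'
      rw [← hu'] at h
      apply mul_left_cancel₀ (pow_ne_zero p hπL0)
      rw [← h, map_mul, map_pow, ← IsScalarTower.algebraMap_apply, ← hα]
      have hpp : πL ^ p = πL ^ (p - 1) * πL := by
        rw [← pow_succ, Nat.sub_add_cancel hp.one_le]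
      rw [hpp]; ring
    rw [hder]
    intro h
    rcases hP.mem_or_mem h with h | h
    · exact hP.ne_top (Ideal.eq_top_of_isUnit_mem _ h (u.isUnit.map _))
    · exact haP (hP.mem_of_pow_mem _ h)


theorem under_mem_primesOver {N : ℕ} (hN : N.Prime) {K L : Type} [Field K] [NumberField K]
    [Field L] [NumberField L] [Algebra K L] (P : Ideal (𝓞 L)) (hP : P.IsPrime)
    (h : (N : 𝓞 L) ∈ P) : (P.under (𝓞 K)) ∈ Ideal.primesOver (Ideal.span {(N : ℤ)}) (𝓞 K) := by
  have : Fact N.Prime := ⟨hN⟩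
  refine ⟨inferInstance, ⟨?_⟩⟩
  have hmax := Int.ideal_span_isMaximal_of_prime N
  refine hmax.eq_of_le ?_ ?_
  · exact Ideal.IsPrime.ne_top inferInstance
  · rw [Ideal.span_singleton_le_iff_mem, Ideal.mem_comap, Ideal.mem_comap]
    simpa using h

theorem card_primesOver_le {p N : ℕ} (hp : p.Prime) (hN : N.Prime) {K : Type} [Field K] [NumberField K]
    [IsCyclotomicExtension {p} ℚ K] :
    (Ideal.primesOver (Ideal.span {(N : ℤ)}) (𝓞 K)).Finite ∧
    (Ideal.primesOver (Ideal.span {(N : ℤ)}) (𝓞 K)).ncard ≤ p - 1 := by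
  have : Fact N.Prime := ⟨hN⟩
  have : NeZero p := ⟨hp.ne_zero⟩
  have hmax := Int.ideal_span_isMaximal_of_prime N
  have : IsGalois ℚ K := IsCyclotomicExtension.isGalois {p} ℚ K
  have h := Ideal.ncard_primesOver_mul_ramificationIdxIn_mul_inertiaDegIn (Ideal.span {(N : ℤ)}) (𝓞 K) Gal(K/ℚ)
  have hr : Module.finrank ℚ K = p - 1 := by
    rw [IsCyclotomicExtension.finrank (n := p) K (Polynomial.cyclotomic.irreducible_rat hp.pos),
      Nat.totient_prime hp]
  rw [IsGalois.card_aut_eq_finrank, hr] at h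
  refine ⟨Algebra.QuasiFinite.finite_primesOver _, Nat.le_of_dvd (by have := hp.two_le; omega) ⟨_, h.symm⟩⟩

theorem exists_S {p N : ℕ} (hp : p.Prime) (hN : N.Prime) {K L : Type} [Field K] [NumberField K]
    [Field L] [NumberField L] [Algebra K L] [IsCyclotomicExtension {p} ℚ K]
    {ζK : K} (hζK : IsPrimitiveRoot ζK p) (a : 𝓞 L) (ha : a ^ p = (N : 𝓞 L))
    (hadj : Algebra.adjoin K {algebraMap (𝓞 L) L a} = ⊤) :
    ∃ S : Finset (Ideal (𝓞 K)), S.card ≤ p ∧ (((p : ℤ) ^ 2) ∣ 1 - (N : ℤ) → S.card ≤ p - 1) ∧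
      (∀ q ∈ S, q.IsPrime ∧ q ≠ ⊥) ∧
      ∀ P : Ideal (𝓞 L), P.IsPrime → P.under (𝓞 K) ∉ S → P.ramificationIdx (𝓞 K) = 1 := by
  classical
  have : Fact p.Prime := ⟨hp⟩
  have : Fact N.Prime := ⟨hN⟩
  have : NeZero p := ⟨hp.ne_zero⟩
  obtain ⟨hfin, hcard⟩ := card_primesOver_le hp hN (K := K)
  have haP : ∀ P : Ideal (𝓞 L), P.IsPrime → P.under (𝓞 K) ∉ hfin.toFinset → a ∉ P := by
    intro P hP h h2
    apply h
    rw [Set.Finite.mem_toFinset]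
    apply under_mem_primesOver hN P hP
    rw [← ha]
    exact P.pow_mem_of_mem h2 p hp.pos
  have hprime : ∀ q ∈ hfin.toFinset, q.IsPrime ∧ q ≠ ⊥ := by
    intro q hq
    rw [Set.Finite.mem_toFinset] at hq
    have := hq.1
    have := hq.2
    refine ⟨hq.1, ?_⟩
    apply Ideal.ne_bot_of_liesOver_of_ne_bot (p := Ideal.span {(N : ℤ)})
    simpa using hN.ne_zero
  rw [Set.ncard_eq_toFinset_card _ hfin] at hcard
  by_cases h : ((p : ℤ) ^ 2) ∣ 1 - (N : ℤ)
  · refine ⟨hfin.toFinset, by omega, fun _ => hcard, hprime, ?_⟩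
    intro P hP hPS
    exact unram_wild hp hζK a ha hadj h P hP (haP P hP hPS)
  · refine ⟨insert (Ideal.span {hζK.toInteger - 1}) hfin.toFinset, ?_, fun h2 => absurd h2 h, ?_, ?_⟩
    · refine (Finset.card_insert_le _ _).trans ?_
      have := hp.two_le; omega
    · intro q hq
      rcases Finset.mem_insert.1 hq with rfl | hq
      · refine ⟨IsCyclotomicExtension.Rat.isPrime_span_zeta_sub_one' p hζK, ?_⟩
        rw [Ne, Ideal.span_singleton_eq_bot]
        exact hζK.zeta_sub_one_prime'.ne_zero
      · exact hprime q hq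
    · intro P hP hPS
      rw [Finset.mem_insert, not_or] at hPS
      refine unram_tame a ha hadj P hP (haP P hP hPS.2) ?_
      intro hpP
      apply hPS.1
      have h3 := under_mem_primesOver hp (K := K) P hP hpP
      have := h3.1
      have := h3.2
      exact IsCyclotomicExtension.Rat.eq_span_zeta_sub_one_of_liesOver' p K hζK _

end PartD

end BlockD

section BlockE

open UniqueFactorizationMonoid
open scoped Pointwise nonZeroDivisors NumberField

section PartE
open NumberField

theorem exists_split {B : Type*} [CommRing B] [IsDedekindDomain B] {P : Ideal B} (hP : P.IsPrime)
    (hP0 : P ≠ ⊥) {x y : B} (hx : x ≠ 0) (hy : y ≠ 0)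
    (h : mu P (Ideal.span {x}) = mu P (Ideal.span {y})) :
    ∃ s t : B, s ∉ P ∧ t ∉ P ∧ x * s = y * t := by
  classical
  have hsx := span_ne_bot hx
  have hsy := span_ne_bot hy
  have hPp : Prime P := Ideal.prime_of_isPrime hP0 hP
  have key : ∀ J : Ideal B, J ≠ ⊥ → P ^ (mu P J) ∣ J := by
    intro J hJ
    apply dvd_of_mu_le (pow_ne_zero _ hP0) hJ
    intro Q hQ hQ0
    rw [mu_pow]
    by_cases hQP : Q = P
    · subst hQP
      have : mu Q Q = 1 := by
        unfold mu
        rw [normalizedFactors_irreducible hPp.irreducible]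
        simp
      rw [this, mul_one]
    · have : mu Q P = 0 := by
        by_contra h0
        have := (mu_pos_iff hQ hQ0 hP0).1 (Nat.pos_of_ne_zero h0)
        exact hQP ((hP.isMaximal hP0).eq_of_le hQ.ne_top this).symm
      rw [this, mul_zero]; exact Nat.zero_le _
  have hPP : mu P P = 1 := by
    unfold mu
    rw [normalizedFactors_irreducible hPp.irreducible]
    simp
  obtain ⟨J, hJ⟩ := key _ hsy
  have hJ0 : J ≠ ⊥ := by
    rintro rfl
    rw [Ideal.mul_bot] at hJ; exact hsy hJ
  have hJP : ¬ J ≤ P := by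
    intro hle
    have h1 := (mu_pos_iff hP hP0 hJ0).2 hle
    have h2 := congrArg (mu P) hJ
    rw [mu_mul P (pow_ne_zero _ hP0) hJ0, mu_pow, hPP] at h2
    omega
  obtain ⟨s, hsJ, hsP⟩ := SetLike.not_le_iff_exists.1 hJP
  have hxm : x ∈ P ^ mu P (Ideal.span {y}) := by
    rw [← h]
    exact Ideal.dvd_span_singleton.1 (key _ hsx)
  have hmem : x * s ∈ Ideal.span {y} := by
    rw [hJ]; exact Ideal.mul_mem_mul hxm hsJ
  obtain ⟨t, ht⟩ := Ideal.mem_span_singleton'.1 hmem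
  refine ⟨s, t, hsP, ?_, by rw [← ht, mul_comm]⟩
  intro htP
  have hs0 : s ≠ 0 := fun h0 => hsP (h0 ▸ P.zero_mem)
  have ht0 : t ≠ 0 := by
    rintro rfl
    rw [zero_mul] at ht
    exact mul_ne_zero hx hs0 ht.symm
  have h3 : mu P (Ideal.span {t} * Ideal.span {y}) = mu P (Ideal.span {x} * Ideal.span {s}) := by
    rw [Ideal.span_singleton_mul_span_singleton, Ideal.span_singleton_mul_span_singleton, ht]
  rw [mu_mul P (span_ne_bot ht0) hsy, mu_mul P hsx (span_ne_bot hs0), h] at h3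
  have h4 := (mu_pos_iff hP hP0 (span_ne_bot ht0)).2 ((Ideal.span_singleton_le_iff_mem _).2 htP)
  have h5 : ¬ 0 < mu P (Ideal.span {s}) := by
    rw [mu_pos_iff hP hP0 (span_ne_bot hs0), Ideal.span_singleton_le_iff_mem]; exact hsP
  omega

theorem unit_not_norm {B : Type*} [CommRing B] [IsDedekindDomain B] {G : Type*} [Group G] [Fintype G]
    [MulSemiringAction G B] {P : Ideal B} (hP : P.IsPrime) (hP0 : P ≠ ⊥)
    (hGP : ∀ g : G, g • P = P) {N p : ℕ} (hp : p.Prime) (hN : N.Prime)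
    (hcard : Nat.card (B ⧸ P) = N) (u : Additive Bˣ) (hup : (u.toMul : B) ^ p = 1)
    (hu1 : (u.toMul : B) - 1 ∉ P) (σ : G) (hu : u ∈ unT σ p) : p ^ 2 ∣ N - 1 := by
  obtain ⟨-, a, b, ha, hb, e⟩ := hu
  set v : B := (u.toMul : B) with hv
  have hmun : ∀ x : B, x ≠ 0 → mu P (Ideal.span {nm σ p x}) = p * mu P (Ideal.span {x}) := by
    intro x hx
    rw [← nm_ideal_span, mu_prod _ _ _ (fun i => smul_ideal_ne_bot _ (span_ne_bot hx))]
    rw [Finset.sum_congr rfl (fun i _ => ?_), Finset.sum_const, Finset.card_range, smul_eq_mul]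
    have := mu_smul (σ ^ i) hP hP0 (span_ne_bot hx)
    rwa [hGP] at this
  have hspan : Ideal.span {nm σ p b} = Ideal.span {nm σ p a} := by
    rw [e]
    exact Ideal.span_singleton_mul_left_unit u.toMul.isUnit _
  have hmu : mu P (Ideal.span {b}) = mu P (Ideal.span {a}) := by
    have := congrArg (mu P) hspan
    rw [hmun b hb, hmun a ha] at this
    exact Nat.eq_of_mul_eq_mul_left hp.pos this
  obtain ⟨s, t, hs, ht, hst⟩ := exists_split hP hP0 hb ha hmu
  have e2 : v * nm σ p s = nm σ p t := by
    have h1 := congrArg (nm σ p) hst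
    rw [nm_mul, nm_mul, e] at h1
    have := nm_ne_zero σ p ha
    apply mul_left_cancel₀ this
    rw [← h1]; ring
  -- residue field
  have hPm := hP.isMaximal hP0
  let _ : Field (B ⧸ P) := Ideal.Quotient.field P
  have : Fact N.Prime := ⟨hN⟩
  have hfin : Finite (B ⧸ P) := Nat.finite_of_card_ne_zero (by rw [hcard]; exact hN.ne_zero)
  have hintg : ∀ x : B, ∃ n : ℤ, x - n ∈ P := by
    intro x
    have h1 : Ideal.Quotient.mk P x ∈ AddSubgroup.zmultiples (1 : B ⧸ P) :=
      mem_zmultiples_of_prime_card hcard one_ne_zero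
    obtain ⟨n, hn⟩ := AddSubgroup.mem_zmultiples_iff.1 h1
    refine ⟨n, ?_⟩
    rw [← Ideal.Quotient.eq, ← hn]
    simp
  have hact : ∀ (g : G) (x : B), Ideal.Quotient.mk P (g • x) = Ideal.Quotient.mk P x := by
    intro g x
    obtain ⟨n, hn⟩ := hintg x
    have h1 : g • (x - n) ∈ P := by
      have := Ideal.smul_mem_pointwise_smul g _ _ hn
      rwa [hGP] at this
    have h2 : g • (n : B) = n := map_intCast (MulSemiringAction.toRingHom G B g) n
    rw [smul_sub, h2] at h1
    rw [Ideal.Quotient.eq]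
    have := P.sub_mem h1 hn
    simpa using this
  have hnm : ∀ x : B, Ideal.Quotient.mk P (nm σ p x) = Ideal.Quotient.mk P x ^ p := by
    intro x
    rw [nm, map_prod, Finset.prod_congr rfl (fun i _ => hact (σ ^ i) x), Finset.prod_const,
      Finset.card_range]
  have e3 := congrArg (Ideal.Quotient.mk P) e2
  rw [map_mul, hnm, hnm] at e3
  have hs' : Ideal.Quotient.mk P s ≠ 0 := by rwa [Ne, Ideal.Quotient.eq_zero_iff_mem]
  have ht' : Ideal.Quotient.mk P t ≠ 0 := by rwa [Ne, Ideal.Quotient.eq_zero_iff_mem]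
  set w : (B ⧸ P)ˣ := Units.mk0 _ ht' / Units.mk0 _ hs' with hw
  have hwp : ((w ^ p : (B ⧸ P)ˣ) : B ⧸ P) = Ideal.Quotient.mk P v := by
    rw [hw, div_pow]
    push_cast [Units.val_div_eq_div_val]
    rw [Units.val_mk0, Units.val_mk0, ← e3, mul_div_assoc, div_self (pow_ne_zero _ hs'), mul_one]
  have : Fact p.Prime := ⟨hp⟩
  have ho : orderOf w = p ^ (1 + 1) := by
    apply orderOf_eq_prime_pow
    · rw [pow_one]
      intro h
      rw [h, Units.val_one, eq_comm, ← map_one (Ideal.Quotient.mk P), Ideal.Quotient.eq] at hwp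
      exact hu1 hwp
    · rw [pow_succ, pow_one, pow_mul]
      ext
      rw [Units.val_pow_eq_pow_val, hwp, ← map_pow, hup, map_one, Units.val_one]
  have h9 := orderOf_dvd_natCard w
  rw [ho, Nat.card_units, hcard] at h9
  exact h9

theorem exists_good_prime {p N : ℕ} (hp : p.Prime) (hN : N.Prime) (hNp : N ≠ p)
    (hmod : N ≡ 1 [MOD p]) {K L : Type} [Field K] [NumberField K]
    [Field L] [NumberField L] [Algebra K L] [IsGalois K L] [IsCyclotomicExtension {p} ℚ K]
    (hG : Nat.card Gal(L/K) = p) (a : 𝓞 L) (ha : a ^ p = (N : 𝓞 L)) :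
    ∃ P : Ideal (𝓞 L), P.IsPrime ∧ P ≠ ⊥ ∧ (N : 𝓞 L) ∈ P ∧ (∀ g : Gal(L/K), g • P = P) ∧
      Nat.card (𝓞 L ⧸ P) = N := by
  have : Fact N.Prime := ⟨hN⟩
  have : NeZero p := ⟨hp.ne_zero⟩
  have hNdvd : ¬ N ∣ p := fun h => hNp ((Nat.prime_dvd_prime_iff_eq hN hp).1 h)
  have hNp' : (Ideal.span {(N : ℤ)}).IsPrime :=
    (Ideal.span_singleton_prime (by simpa using hN.ne_zero)).2 (Nat.prime_iff_prime_int.1 hN)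
  obtain ⟨P, hP, hPN⟩ := Ideal.nonempty_primesOver (S := 𝓞 L) (P := Ideal.span {(N : ℤ)})
  have hNP : (N : 𝓞 L) ∈ P := by
    have h1 : (N : ℤ) ∈ P.under ℤ := by
      rw [← hPN.over]; exact Ideal.mem_span_singleton_self _
    have h2 := Ideal.mem_comap.1 h1
    simpa using h2
  have hP0 : P ≠ ⊥ := by
    apply Ideal.ne_bot_of_liesOver_of_ne_bot (p := Ideal.span {(N : ℤ)})
    simpa using hN.ne_zero
  have haP : a ∈ P := hP.mem_of_pow_mem p (ha ▸ hNP)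
  have ha0 : a ≠ 0 := by
    rintro rfl
    rw [zero_pow hp.ne_zero] at ha
    exact hN.ne_zero (by exact_mod_cast ha.symm)
  obtain ⟨hq1, hq2⟩ := under_mem_primesOver (K := K) hN P hP hNP
  have hq0 : P.under (𝓞 K) ≠ ⊥ := under_ne_bot hP0
  have e1 : (P.under (𝓞 K)).ramificationIdx ℤ = 1 :=
    IsCyclotomicExtension.Rat.ramificationIdx_eq_of_not_dvd N K _ hNdvd
  have f1 : (P.under (𝓞 K)).inertiaDeg ℤ = 1 := by
    rw [IsCyclotomicExtension.Rat.inertiaDeg_eq_of_not_dvd N K _ hNdvd]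
    have : ((N : ℕ) : ZMod p) = ((1 : ℕ) : ZMod p) := (ZMod.natCast_eq_natCast_iff _ _ _).2 hmod
    rw [this]; simp
  have et : P.ramificationIdx ℤ = (P.under (𝓞 K)).ramificationIdx ℤ * P.ramificationIdx (𝓞 K) :=
    Ideal.ramificationIdx_tower (R := ℤ) (P.under (𝓞 K)) P
  have ft : P.inertiaDeg ℤ = (P.under (𝓞 K)).inertiaDeg ℤ * P.inertiaDeg (𝓞 K) :=
    Ideal.inertiaDeg_tower (R := ℤ) (P.under (𝓞 K)) P
  have hmu : P.ramificationIdx ℤ = p * mu P (Ideal.span {a}) := by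
    rw [← mu_map_under (A := ℤ) hP0, ← mu_pow, ← hPN.over, Ideal.map_span, Ideal.span_singleton_pow, ha]
    simp
  have hpos : 0 < mu P (Ideal.span {a}) :=
    (mu_pos_iff hP hP0 (span_ne_bot ha0)).2 ((Ideal.span_singleton_le_iff_mem _).2 haP)
  rcases ram_cases (A := 𝓞 K) (G := Gal(L/K)) hp hG hP hP0 with h | ⟨h, hinv⟩
  · exfalso
    rw [et, e1, h] at hmu
    have := hp.two_le
    have := Nat.le_mul_of_pos_right p hpos
    omega
  refine ⟨P, hP, hP0, hNP, hinv, ?_⟩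
  have hfund := Ideal.ncard_primesOver_mul_ramificationIdxIn_mul_inertiaDegIn (P.under (𝓞 K)) (𝓞 L) Gal(L/K)
  rw [Ideal.ramificationIdxIn_eq_ramificationIdx (P.under (𝓞 K)) P Gal(L/K),
    Ideal.inertiaDegIn_eq_inertiaDeg (P.under (𝓞 K)) P Gal(L/K), h, hG] at hfund
  have f2 : P.inertiaDeg (𝓞 K) = 1 := by
    have h3 : p * ((Ideal.primesOver (P.under (𝓞 K)) (𝓞 L)).ncard * P.inertiaDeg (𝓞 K)) = p * 1 := by
      rw [mul_one]; nth_rewrite 2 [← hfund]; ring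
    have h4 := Nat.eq_of_mul_eq_mul_left hp.pos h3
    exact Nat.eq_one_of_mul_eq_one_left h4
  have h5 := Ideal.pow_inertiaDeg N P
  rw [ft, f1, f2, one_mul, pow_one] at h5
  rw [h5]; rfl

theorem partE {p N : ℕ} (hp : p.Prime) (hN : N.Prime) (hNp : N ≠ p)
    (hmod : N ≡ 1 [MOD p]) {K L : Type} [Field K] [NumberField K]
    [Field L] [NumberField L] [Algebra K L] [IsGalois K L] [IsCyclotomicExtension {p} ℚ K]
    (hG : Nat.card Gal(L/K) = p) (a : 𝓞 L) (ha : a ^ p = (N : 𝓞 L))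
    {ζK : K} (hζK : IsPrimitiveRoot ζK p) (σ : Gal(L/K))
    (hH0 : (un (B := 𝓞 L) σ p).range.relIndex (ud σ).ker ≠ 0)
    (hp2 : ¬ (p : ℤ) ^ 2 ∣ 1 - (N : ℤ)) :
    p ≤ (unT (B := 𝓞 L) σ p).relIndex (ud σ).ker := by
  have hpf : Fact p.Prime := ⟨hp⟩
  have hσp : σ ^ p = 1 := by rw [← hG]; exact pow_card_eq_one'
  have hmul := AddSubgroup.relIndex_mul_relIndex _ _ _ (un_range_le (B := 𝓞 L) hσp) (unT_le σ p)
  have hne : (unT (B := 𝓞 L) σ p).relIndex (ud σ).ker ≠ 0 := by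
    intro h; rw [h, mul_zero] at hmul; exact hH0 hmul.symm
  obtain ⟨P, hP, hP0, hNP, hinv, hcard⟩ := exists_good_prime hp hN hNp hmod hG a ha
  obtain ⟨v, hv, hvp⟩ := exists_zeta_unit hp hζK
  let u : Additive (𝓞 L)ˣ := Additive.ofMul (Units.map (algebraMap (𝓞 K) (𝓞 L) : 𝓞 K →* 𝓞 L) v)
  have huval : (u.toMul : 𝓞 L) = algebraMap (𝓞 K) (𝓞 L) v := rfl
  have hvp1 : v ^ p = 1 := hvp.pow_eq_one
  have hup : (u.toMul : 𝓞 L) ^ p = 1 := by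
    rw [huval, ← map_pow, ← Units.val_pow_eq_pow_val, hvp1, Units.val_one, map_one]
  have huker : u ∈ (ud (B := 𝓞 L) σ).ker := by
    rw [mem_ud_ker, huval]
    exact smul_algebraMap σ _
  have hu1 : (u.toMul : 𝓞 L) - 1 ∉ P := by
    intro h
    have hz : (v : 𝓞 K) = hζK.toInteger := by
      apply RingOfIntegers.ext
      exact hv
    have has := IsCyclotomicExtension.Rat.associated_zeta_sub_one_pow_prime p hζK
    obtain ⟨w, hw⟩ := has
    have h1 := congrArg (algebraMap (𝓞 K) (𝓞 L)) hw
    rw [← hz, map_mul, map_pow, map_sub, map_one, map_natCast, ← huval] at h1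
    have hpP : (p : 𝓞 L) ∈ P := by
      rw [← h1]
      exact P.mul_mem_right _ (P.pow_mem_of_mem h _ (by have := hp.two_le; omega))
    have hcop : Nat.Coprime p N := (Nat.coprime_primes hp hN).2 hNp.symm
    have h2 := Nat.isCoprime_iff_coprime.2 hcop
    obtain ⟨r, s, hrs⟩ := h2
    apply hP.ne_top
    rw [Ideal.eq_top_iff_one]
    have h3 : ((r * p + s * N : ℤ) : 𝓞 L) = 1 := by rw [hrs]; simp
    rw [← h3]; push_cast
    exact P.add_mem (P.mul_mem_left _ hpP) (P.mul_mem_left _ hNP)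
  have hunT : u ∉ unT (B := 𝓞 L) σ p := by
    intro h
    have h1 := unit_not_norm hP hP0 hinv hp hN hcard u hup hu1 σ h
    apply hp2
    have h2 : ((p ^ 2 : ℕ) : ℤ) ∣ ((N - 1 : ℕ) : ℤ) := Int.natCast_dvd_natCast.2 h1
    rw [Nat.cast_sub hN.one_le] at h2
    push_cast at h2
    rw [← dvd_neg]; simpa using h2
  have hpu : p • u = 0 := by
    apply Additive.toMul.injective
    apply Units.ext
    rw [toMul_nsmul, Units.val_pow_eq_pow_val, hup]; rfl
  apply Nat.le_of_dvd (Nat.pos_of_ne_zero hne)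
  let H := (unT (B := 𝓞 L) σ p).addSubgroupOf (ud σ).ker
  let y : (ud (B := 𝓞 L) σ).ker ⧸ H := QuotientAddGroup.mk ⟨u, huker⟩
  have hy : addOrderOf y = p := by
    apply addOrderOf_eq_prime
    · rw [← QuotientAddGroup.mk_nsmul]
      have : p • (⟨u, huker⟩ : (ud (B := 𝓞 L) σ).ker) = 0 := Subtype.ext hpu
      rw [this]; rfl
    · intro h
      rw [QuotientAddGroup.eq_zero_iff] at h
      exact hunT h
  have h7 := addOrderOf_dvd_natCard y
  rw [hy] at h7
  exact h7

end PartE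

end BlockE

section Final
open scoped Pointwise nonZeroDivisors NumberField

theorem main_bound {p N : ℕ} (hp : p.Prime) (hpodd : Odd p) (hN : N.Prime) (hNp : N ≠ p)
    (hmod : N ≡ 1 [MOD p]) {K L : Type} [Field K] [NumberField K]
    [Field L] [NumberField L] [Algebra K L] [IsGalois K L] [IsCyclic Gal(L/K)]
    [IsCyclotomicExtension {p} ℚ K]
    (hG : Nat.card Gal(L/K) = p) {ζK : K} (hζK : IsPrimitiveRoot ζK p)
    (hreg : ¬ p ∣ Nat.card (ClassGroup (𝓞 K)))
    (a : 𝓞 L) (ha : a ^ p = (N : 𝓞 L))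
    (hadj : Algebra.adjoin K {algebraMap (𝓞 L) L a} = ⊤) :
    Nat.card {c : ClassGroup (𝓞 L) // c ^ p = 1} ≤ p ^ ((p - 1) * (p - 2)) := by
  have hp3 : 2 < p := by
    rcases hpodd with ⟨k, hk⟩; have := hp.two_le; omega
  obtain ⟨σ, hσ⟩ := IsCyclic.exists_generator (α := Gal(L/K))
  obtain ⟨S, hS1, hS2, hS3, hS4⟩ := exists_S hp hN hζK a ha hadj
  have hex : ∀ q : Ideal (𝓞 K), ∃ P : Ideal (𝓞 L), q ∈ S → P.IsPrime ∧ P ≠ ⊥ ∧ P.under (𝓞 K) = q := by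
    intro q
    by_cases hq : q ∈ S
    · obtain ⟨h1, h2⟩ := hS3 q hq
      obtain ⟨P, hP, hPq⟩ := Ideal.nonempty_primesOver (S := 𝓞 L) (P := q)
      exact ⟨P, fun _ => ⟨hP, Ideal.ne_bot_of_liesOver_of_ne_bot h2 P, hPq.over.symm⟩⟩
    · exact ⟨⊥, fun h => absurd h hq⟩
  choose rep hrep using hex
  obtain ⟨hH, hH0⟩ := herbrand_apply hp hpodd hG hσ hζK
  have h90 : ∀ x y : 𝓞 L, x ≠ 0 → y ≠ 0 → nm σ p x = nm σ p y →
      ∃ z : 𝓞 L, z ≠ 0 ∧ x * σ • z = y * z := fun x y hx hy hxy => h90_int hp hG hσ x y hx hy hxy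
  have hcount := counting (A := 𝓞 K) (B := 𝓞 L) hp hG hσ hreg S rep hrep
    (fun P hP _ hPS => hS4 P hP hPS) h90 hH hH0
  have hT := card_torsion_le (𝓞 K) (B := 𝓞 L) hp hG hσ hreg
  have hmul := AddSubgroup.relIndex_mul_relIndex _ _ _ (un_range_le (B := 𝓞 L) (σ := σ) (p := p)
    (by rw [← hG]; exact pow_card_eq_one')) (unT_le σ p)
  have hne : (unT (B := 𝓞 L) σ p).relIndex (ud σ).ker ≠ 0 := by
    intro h; rw [h, mul_zero] at hmul; exact hH0 hmul.symm
  have hinv : Nat.card (invC (𝓞 L) σ p) ≤ p ^ (p - 2) := by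
    by_cases h : ((p : ℤ) ^ 2) ∣ 1 - (N : ℤ)
    · have h1 : Nat.card (invC (𝓞 L) σ p) * p ≤ p ^ (p - 2) * p := by
        calc Nat.card (invC (𝓞 L) σ p) * p
            ≤ Nat.card (invC (𝓞 L) σ p) * (unT (B := 𝓞 L) σ p).relIndex (ud σ).ker * p :=
              Nat.mul_le_mul_right _ (Nat.le_mul_of_pos_right _ (Nat.pos_of_ne_zero hne))
          _ ≤ p ^ S.card := hcount
          _ ≤ p ^ (p - 1) := Nat.pow_le_pow_right hp.pos (hS2 h)
          _ = p ^ (p - 2) * p := by rw [← pow_succ]; congr 1; omega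
      exact Nat.le_of_mul_le_mul_right h1 hp.pos
    · have hE := partE hp hN hNp hmod hG a ha hζK σ hH0 h
      have h1 : Nat.card (invC (𝓞 L) σ p) * (p * p) ≤ p ^ (p - 2) * (p * p) := by
        calc Nat.card (invC (𝓞 L) σ p) * (p * p) = Nat.card (invC (𝓞 L) σ p) * p * p := by ring
          _ ≤ Nat.card (invC (𝓞 L) σ p) * (unT (B := 𝓞 L) σ p).relIndex (ud σ).ker * p :=
              Nat.mul_le_mul_right _ (Nat.mul_le_mul_left _ hE)
          _ ≤ p ^ S.card := hcount
          _ ≤ p ^ p := Nat.pow_le_pow_right hp.pos hS1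
          _ = p ^ (p - 2) * (p * p) := by rw [← sq, ← pow_add]; congr 1; omega
      exact Nat.le_of_mul_le_mul_right h1 (Nat.mul_pos hp.pos hp.pos)
  calc Nat.card {c : ClassGroup (𝓞 L) // c ^ p = 1}
      ≤ Nat.card {c : ClassGroup (𝓞 L) // c ^ p = 1 ∧ sig σ c = c} ^ (p - 1) := hT
    _ ≤ (p ^ (p - 2)) ^ (p - 1) := Nat.pow_le_pow_left hinv _
    _ = p ^ ((p - 1) * (p - 2)) := by rw [← pow_mul, mul_comm]

end Final

/-- Let `p` be a regular prime (odd, not dividing the class number of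
`K = ℚ(ζ_p)`) and `N ≠ p` a prime with `N ≡ 1 (mod p)`.  Then
`rk_p(Cl(L)) ≤ (p-1)(p-2)` for `L = ℚ(ζ_p, N^{1/p})`. -/
theorem stmt7 (p N : ℕ) (hp : p.Prime) (hpodd : Odd p) (hN : N.Prime) (hNp : N ≠ p)
    (hmod : N ≡ 1 [MOD p])
    (K : Type) [Field K] [NumberField K]
    (ζK : K) (hζK : IsPrimitiveRoot ζK p)
    (hKgen : Algebra.adjoin ℚ {ζK} = (⊤ : Subalgebra ℚ K))
    (hreg : ¬ p ∣ Nat.card (ClassGroup (𝓞 K)))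
    (L : Type) [Field L] [NumberField L]
    (ζ : L) (hζ : IsPrimitiveRoot ζ p)
    (α : L) (hα : α ^ p = (N : L))
    (hLgen : Algebra.adjoin ℚ {ζ, α} = (⊤ : Subalgebra ℚ L)) :
    pRank p (ClassGroup (𝓞 L)) ≤ (p - 1) * (p - 2) := by
  have hcyc : IsCyclotomicExtension {p} ℚ K := cyc_of_gen hp hζK hKgen
  obtain ⟨f, hf⟩ := exists_emb hp hζK hζ
  let _ : Algebra K L := f.toAlgebra
  have hf' : algebraMap K L ζK = ζ := hf
  have htop := adjoin_top hf' hLgen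
  obtain ⟨h1, h2, h3, h4, h5⟩ := kummer_setup hp hN hζK hα htop
  have hintg : IsIntegral ℤ α := by
    refine IsIntegral.of_pow hp.pos ?_
    rw [hα]
    have h0 := isIntegral_algebraMap (R := ℤ) (A := L) (x := (N : ℤ))
    simpa using h0
  obtain ⟨a, haα⟩ : ∃ a : 𝓞 L, algebraMap (𝓞 L) L a = α := ⟨⟨α, hintg⟩, rfl⟩
  have ha : a ^ p = (N : 𝓞 L) := by
    apply RingOfIntegers.ext
    change algebraMap (𝓞 L) L (a ^ p) = algebraMap (𝓞 L) L (N : 𝓞 L)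
    rw [map_pow, haα, hα, map_natCast]
  have hadj : Algebra.adjoin K {algebraMap (𝓞 L) L a} = ⊤ := by
    rw [haα]
    have h6 := IntermediateField.adjoin_simple_toSubalgebra_of_isAlgebraic
      (Algebra.IsAlgebraic.isAlgebraic (R := K) α)
    rw [← h6, htop, IntermediateField.top_toSubalgebra]
  have hb := main_bound hp hpodd hN hNp hmod h4 hζK hreg a ha hadj
  unfold pRank
  have hne : Nat.card {g : ClassGroup (𝓞 L) // g ^ p = 1} ≠ 0 := by
    have : Nonempty {g : ClassGroup (𝓞 L) // g ^ p = 1} := ⟨⟨1, one_pow p⟩⟩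
    exact Nat.card_pos.ne'
  have h7 := (Nat.le_of_dvd (Nat.pos_of_ne_zero hne) (Nat.ordProj_dvd _ p)).trans hb
  exact (Nat.pow_le_pow_iff_right hp.one_lt).1 h7
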